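/- arXiv:math/9207202 — 2 statements merged into one kernel-verified Lean document; each statement's English description precedes it below -/
import Mathlib

section
/- Let f : U → ℂⁿ be a bounded nonconstant holomorphic mapping of the unit disk and let h : U → U be holomorphic with h(0) = 0. Then the holomorphic measures μ(dz, f) and μ(dz, f∘h) are equal if and only if h is an inner function, i.e. the radial limits of h have modulus 1 at almost every point of the unit circle. -/
open MeasureTheory Complex Filter Metric Set Topology

noncomputable section

/-- The open unit disk in `ℂ`. -/
def unitDisk : Set ℂ := Metric.ball (0 : ℂ) 1

/-- The unit circle in `ℂ`. -/
def unitCircleS : Set ℂ := Metric.sphere (0 : ℂ) 1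

/-- `ℂⁿ` with the Euclidean norm. -/
abbrev En (n : ℕ) := EuclideanSpace ℂ (Fin n)

instance (n : ℕ) : MeasurableSpace (En n) := borel _

instance (n : ℕ) : BorelSpace (En n) := ⟨rfl⟩

section Basic

variable {E : Type*} [NormedAddCommGroup E] [NormedSpace ℂ E]

open Classical in
/-- The radial limit of `f` at a boundary point `ζ`; junk value `0` if it does not exist. -/
def radialLimit (f : ℂ → E) (ζ : ℂ) : E :=
  if h : ∃ w : E, Tendsto (fun r : ℝ => f ((r : ℂ) * ζ)) (𝓝[<] (1 : ℝ)) (𝓝 w)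
  then h.choose else 0

/-- The boundary values of `f`, parametrized by angle. -/
def bdryMap (f : ℂ → E) (θ : ℝ) : E := radialLimit f (Complex.exp ((θ : ℂ) * Complex.I))

/-- Normalized arclength measure (harmonic measure at the origin) of a subset of the circle. -/
def hm0 (A : Set ℂ) : ℝ :=
  (2 * Real.pi)⁻¹ *
    (volume {θ : ℝ | θ ∈ Set.Ioc (0 : ℝ) (2 * Real.pi) ∧
      Complex.exp ((θ : ℂ) * Complex.I) ∈ A}).toReal

/-- `μ(A, f)` : the holomorphic measure of a set `A ⊆ E` under `f`. -/
def holoMeasSet (f : ℂ → E) (A : Set E) : ℝ :=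
  hm0 {ζ | ζ ∈ unitCircleS ∧ radialLimit f ζ ∈ A}

/-- `f` is holomorphic on the unit disk. -/
def HoloDisk (f : ℂ → E) : Prop := DifferentiableOn ℂ f unitDisk

def BoundedOnDisk (f : ℂ → E) : Prop := ∃ M : ℝ, ∀ ζ ∈ unitDisk, ‖f ζ‖ ≤ M

def UnifBounded (f : ℕ → ℂ → E) : Prop := ∃ R : ℝ, ∀ j : ℕ, ∀ ζ ∈ unitDisk, ‖f j ζ‖ ≤ R

/-- The cluster of a sequence of analytic disks. -/
def cluster (f : ℕ → ℂ → E) : Set E :=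
  {z | ∀ V ∈ 𝓝 z, {j : ℕ | ∃ ζ ∈ unitDisk, f j ζ ∈ V}.Infinite}

/-- A point of the cluster is essential if it is not nonessential. -/
def Essential (f : ℕ → ℂ → E) (z : E) : Prop :=
  z ∈ cluster f ∧
    ¬ ∃ r : ℝ, 0 < r ∧ Tendsto (fun j => holoMeasSet (f j) (Metric.ball z r)) atTop (𝓝 0)

def TotEssential (f : ℕ → ℂ → E) (z : E) : Prop :=
  z ∈ cluster f ∧
    ∀ r : ℝ, 0 < r → 0 < Filter.liminf (fun j => holoMeasSet (f j) (Metric.ball z r)) atTop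

def PerfectSeq (f : ℕ → ℂ → E) : Prop := ∀ z ∈ cluster f, Essential f z

def TotPerfectSeq (f : ℕ → ℂ → E) : Prop := ∀ z ∈ cluster f, TotEssential f z

/-- Superharmonic functions on a planar set (lower semicontinuous + super-mean-value). -/
def SuperharmonicOn (u : ℂ → ℝ) (D : Set ℂ) : Prop :=
  LowerSemicontinuousOn u D ∧
  ∀ c : ℂ, ∀ ρ : ℝ, 0 < ρ → Metric.closedBall c ρ ⊆ D →
    (2 * Real.pi)⁻¹ *
        (∫ θ in (0:ℝ)..(2 * Real.pi), u (c + (ρ : ℂ) * Complex.exp ((θ : ℂ) * Complex.I)))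
      ≤ u c

/-- Harmonic measure of `A ⊆ closure U` at `ζ ∈ U` (Perron-type definition: infimum of
positive superharmonic functions that are at least 1 on `A`, radially at boundary points). -/
def hmU (ζ : ℂ) (A : Set ℂ) : ℝ :=
  sInf {t : ℝ | ∃ u : ℂ → ℝ, SuperharmonicOn u unitDisk ∧ (∀ w ∈ unitDisk, 0 ≤ u w) ∧
    (∀ w ∈ A ∩ unitDisk, 1 ≤ u w) ∧
    (∀ w ∈ A ∩ unitCircleS, 1 ≤ Filter.liminf (fun r : ℝ => u ((r : ℂ) * w)) (𝓝[<] (1:ℝ))) ∧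
    t = u ζ}

/-- The full preimage in the closed disk (interior points and boundary radial-limit points). -/
def diskPreimage (f : ℂ → E) (V : Set E) : Set ℂ :=
  {ζ | ζ ∈ unitDisk ∧ f ζ ∈ V} ∪ {ζ | ζ ∈ unitCircleS ∧ radialLimit f ζ ∈ V}

/-- `ω(z, V, f(U))`. -/
def omDisk (f : ℂ → E) (V : Set E) (z : E) : ℝ :=
  sSup {t : ℝ | ∃ ζ ∈ unitDisk, f ζ = z ∧ t = hmU ζ (diskPreimage f V)}

/-- `ω(z, V, L)` for open `V`. -/
def omCluster (f : ℕ → ℂ → E) (V : Set E) (z : E) : ℝ :=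
  Filter.limsup (fun p : E × ℕ => omDisk (f p.2) V p.1) (𝓝 z ×ˢ (Filter.atTop : Filter ℕ))

/-- `ω(z, A, L)` for an arbitrary set `A`. -/
def omClusterSet (f : ℕ → ℂ → E) (A : Set E) (z : E) : ℝ :=
  sInf {t : ℝ | ∃ V : Set E, IsOpen V ∧ A ⊆ V ∧ t = omCluster f V z}

/-- Plurisubharmonic (EReal-valued): upper semicontinuous, and on every closed disk in a
complex line, domination on the boundary circle by a harmonic comparison function (the real
part of a polynomial) implies domination inside. -/
def PSHOn (u : E → EReal) (D : Set E) : Prop :=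
  UpperSemicontinuousOn u D ∧
  ∀ (z w : E) (ρ : ℝ), 0 < ρ → (∀ ζ : ℂ, ‖ζ‖ ≤ ρ → z + ζ • w ∈ D) →
    ∀ p : Polynomial ℂ,
      (∀ ζ : ℂ, ‖ζ‖ = ρ → u (z + ζ • w) ≤ ((p.eval ζ).re : EReal)) →
      ∀ ζ : ℂ, ‖ζ‖ ≤ ρ → u (z + ζ • w) ≤ ((p.eval ζ).re : EReal)

/-- The algebra `𝓗(L)`: continuous functions on the cluster that are uniform limits of
functions holomorphic in neighborhoods of the cluster. -/
def InHL (f : ℕ → ℂ → E) (h : E → ℂ) : Prop :=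
  ContinuousOn h (cluster f) ∧
  ∀ ε : ℝ, 0 < ε → ∃ (V : Set E) (g : E → ℂ), IsOpen V ∧ cluster f ⊆ V ∧
    DifferentiableOn ℂ g V ∧ ∀ z ∈ cluster f, ‖h z - g z‖ ≤ ε

end Basic

section MeasureStuff

variable {E : Type*} [NormedAddCommGroup E] [NormedSpace ℂ E] [MeasurableSpace E]

/-- Weak convergence of the holomorphic measures of the `f j` to `μ`. -/
def WeakConv (f : ℕ → ℂ → E) (μ : Measure E) : Prop :=
  ∀ φ : E → ℝ, Continuous φ →
    Tendsto (fun j => (2 * Real.pi)⁻¹ * ∫ θ in (0:ℝ)..(2 * Real.pi), φ (bdryMap (f j) θ))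
      atTop (𝓝 (∫ z, φ z ∂μ))

/-- The (closed) support of a measure. -/
def measSupport (μ : Measure E) : Set E := {z | ∀ V ∈ 𝓝 z, μ V ≠ 0}

/-- A leaf: a uniformly bounded sequence of analytic disks whose holomorphic measures
converge weakly (to its Jensen measure `μ`); its centers converge to the center. -/
structure Leaf (E : Type*) [NormedAddCommGroup E] [NormedSpace ℂ E] [MeasurableSpace E] where
  f : ℕ → ℂ → E
  holo : ∀ j, HoloDisk (f j)
  bdd : UnifBounded f
  μ : Measure E
  conv : WeakConv f μ
  center : E
  centerLim : Tendsto (fun j => f j 0) atTop (𝓝 center)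

def clusterL (L : Leaf E) : Set E := cluster L.f

def suppL (L : Leaf E) : Set E := measSupport L.μ

def PerfectLeaf (L : Leaf E) : Prop := PerfectSeq L.f

def TrivialLeaf (L : Leaf E) : Prop := suppL L = {L.center}

/-- The Möbius automorphism `G_a` of the unit disk. -/
def moeb (a ζ : ℂ) : ℂ := (ζ + a) / (1 + (starRingEnd ℂ) a * ζ)

/-- `M` is a perfection of `N`: a perfect leaf whose cluster is the set of essential points
of `N` and with the same Jensen measure. -/
def IsPerfectionOf (M N : Leaf E) : Prop :=
  PerfectLeaf M ∧ clusterL M = {z | Essential N.f z} ∧ M.μ = N.μ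

/-- `M` is a subleaf of `L` at the point `z`: a perfection of a leaf extracted from a
sequence `f_{j_k} ∘ G_{a_k}` with `f_{j_k}(a_k) → z`. -/
def IsSubleafAt (L M : Leaf E) (z : E) : Prop :=
  ∃ (N : Leaf E) (j k : ℕ → ℕ) (a : ℕ → ℂ),
    StrictMono j ∧ (∀ i, a i ∈ unitDisk) ∧
    Tendsto (fun i => L.f (j i) (a i)) atTop (𝓝 z) ∧
    StrictMono k ∧
    (∀ i, N.f i = fun ζ => L.f (j (k i)) (moeb (a (k i)) ζ)) ∧
    IsPerfectionOf M N

def IsInnerPoint (L : Leaf E) (z : E) : Prop :=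
  ∃ M : Leaf E, IsSubleafAt L M z ∧ ¬ TrivialLeaf M

def MinimalAt (L : Leaf E) (z : E) : Prop :=
  ¬ ∃ M : Leaf E, IsSubleafAt L M z ∧ ¬ TrivialLeaf M ∧ clusterL M ⊂ clusterL L

end MeasureStuff

/-- The polynomial hull of a set in `ℂⁿ`. -/
def polyHull {n : ℕ} (X : Set (En n)) : Set (En n) :=
  {z | ∀ p : MvPolynomial (Fin n) ℂ,
    ‖MvPolynomial.eval (fun i => z i) p‖ ≤ ⨆ w ∈ X, ‖MvPolynomial.eval (fun i => w i) p‖}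

theorem norm_le_mul_of_sphere_off_point {E : ℂ → ℂ} {ζ₀ : ℂ} {K ε : ℝ}
    (hE : DiffContOnCl ℂ E (ball 0 1)) (hK : ∀ z ∈ closedBall (0 : ℂ) 1, ‖E z‖ ≤ K * ‖z - ζ₀‖)
    (hζ₀ : ‖ζ₀‖ = 1) (hε : 0 < ε)
    (hs : ∀ z ∈ sphere (0 : ℂ) 1, ‖E z‖ ≤ ε * ‖z - ζ₀‖) :
    ∀ z ∈ ball (0 : ℂ) 1, ‖E z‖ ≤ ε * ‖z - ζ₀‖ := by
  have hball : ∀ z ∈ ball (0 : ℂ) 1, z ≠ ζ₀ := by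
    rintro z hz rfl
    rw [mem_ball_zero_iff] at hz
    linarith
  have hq {C : ℝ} {z : ℂ} (hz : z ≠ ζ₀) (h : ‖E z‖ ≤ C * ‖z - ζ₀‖) : ‖E z / (z - ζ₀)‖ ≤ C := by
    rw [norm_div, div_le_iff₀ (norm_pos_iff.2 (sub_ne_zero.2 hz))]
    exact h
  have hdisk (k : ℕ) : DiffContOnCl ℂ (fun z => (E z / (z - ζ₀)) ^ k * (z - ζ₀)) (ball 0 1) := by
    refine ⟨?_, ?_⟩
    · refine DifferentiableOn.mul (DifferentiableOn.pow (hE.differentiableOn.div (by fun_prop) ?_) k)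
        (by fun_prop)
      exact fun z hz => sub_ne_zero.2 (hball z hz)
    · rw [closure_ball _ one_ne_zero]
      have hc := hE.continuousOn
      rw [closure_ball _ one_ne_zero] at hc
      intro z hz
      by_cases hzz : z = ζ₀
      · subst hzz
        have : ContinuousWithinAt (fun w : ℂ => |K| ^ k * ‖w - z‖) (closedBall 0 1) z := by
          fun_prop
        suffices Tendsto (fun w => (E w / (w - z)) ^ k * (w - z)) (𝓝[closedBall 0 1] z) (𝓝 0) by
          simpa [ContinuousWithinAt] using this
        refine squeeze_zero_norm' ?_ (by simpa [ContinuousWithinAt] using this)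
        filter_upwards [self_mem_nhdsWithin] with w hw
        rw [norm_mul, norm_pow]
        by_cases hwz : w = z
        · simp [hwz]
        · gcongr
          exact (hq hwz (hK w hw)).trans (le_abs_self K)
      · have h1 : ContinuousWithinAt (fun w => w - ζ₀) (closedBall 0 1) z := by fun_prop
        exact (((hc z hz).div h1 (sub_ne_zero.2 hzz)).pow k).mul h1
  intro z hz
  have hzz := hball z hz
  have hpos : 0 < ‖z - ζ₀‖ := norm_pos_iff.2 (sub_ne_zero.2 hzz)
  have hbd (k : ℕ) : ‖E z / (z - ζ₀)‖ ^ k * ‖z - ζ₀‖ ≤ ε ^ k * 2 := by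
    rw [← norm_pow, ← norm_mul]
    refine Complex.norm_le_of_forall_mem_frontier_norm_le isBounded_ball (hdisk k) ?_
      (subset_closure hz)
    intro w hw
    rw [frontier_ball _ one_ne_zero] at hw
    rw [norm_mul, norm_pow]
    by_cases hwz : w = ζ₀
    · simp only [hwz, sub_self, norm_zero, mul_zero]; positivity
    · have := hq hwz (hs w hw)
      have h2 : ‖w - ζ₀‖ ≤ 2 := by
        refine (norm_sub_le _ _).trans ?_
        rw [mem_sphere_zero_iff_norm] at hw
        linarith
      gcongr
  rw [← div_le_iff₀ hpos, ← norm_sub_rev, norm_sub_rev, ← norm_div]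
  by_contra! hcon
  obtain ⟨k, hk⟩ := pow_unbounded_of_one_lt (2 / ‖z - ζ₀‖) ((one_lt_div hε).2 hcon)
  have h1 := hbd k
  rw [div_pow, div_lt_div_iff₀ hpos (by positivity)] at hk
  linarith

theorem peak_norm_sq {z ζ₀ : ℂ} (hζ₀ : ‖ζ₀‖ = 1) (hz : ‖z‖ = 1) :
    ‖(ζ₀ + z) / (2 * ζ₀)‖ ^ 2 = 1 - ‖z - ζ₀‖ ^ 2 / 4 := by
  have := parallelogram_law_with_norm ℝ z ζ₀
  rw [norm_div, norm_mul, hζ₀, add_comm ζ₀ z]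
  simp only [hz, hζ₀] at this
  simp
  nlinarith

theorem norm_le_mul_near_of_sphere {E : ℂ → ℂ} {ζ₀ : ℂ} {K : ℝ}
    (hE : DiffContOnCl ℂ E (ball 0 1)) (hK : ∀ z ∈ closedBall (0 : ℂ) 1, ‖E z‖ ≤ K * ‖z - ζ₀‖)
    (hζ₀ : ‖ζ₀‖ = 1)
    (hs : ∀ ε > 0, ∃ ρ > 0, ∀ z ∈ sphere (0 : ℂ) 1, ‖z - ζ₀‖ < ρ → ‖E z‖ ≤ ε * ‖z - ζ₀‖) :
    ∀ ε > 0, ∃ ρ > 0, ∀ z ∈ ball (0 : ℂ) 1, ‖z - ζ₀‖ < ρ → ‖E z‖ ≤ ε * ‖z - ζ₀‖ := by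
  intro ε hε
  obtain ⟨ρ, hρ, hs⟩ := hs (ε / 2) (by positivity)
  have hζne : ζ₀ ≠ 0 := by rintro rfl; simp at hζ₀
  set φ : ℂ → ℂ := fun z => (ζ₀ + z) / (2 * ζ₀) with hφ
  have hφ1 : ∀ z ∈ closedBall (0 : ℂ) 1, ‖φ z‖ ≤ 1 := by
    intro z hz
    rw [mem_closedBall_zero_iff] at hz
    simp only [hφ, norm_div, norm_mul, hζ₀]
    have := norm_add_le ζ₀ z
    simp
    linarith
  set κ : ℝ := max 0 (1 - ρ ^ 2 / 4) with hκ
  have hκ1 : κ < 1 := max_lt one_pos (by nlinarith [sq_pos_of_pos hρ])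
  obtain ⟨m, hm⟩ : ∃ m : ℕ, |K| * κ ^ m < ε / 2 := by
    have : Tendsto (fun m : ℕ => |K| * κ ^ m) atTop (𝓝 (|K| * 0)) :=
      (tendsto_pow_atTop_nhds_zero_of_lt_one (le_max_left _ _) hκ1).const_mul _
    rw [mul_zero] at this
    exact (this.eventually_lt_const (by positivity)).exists
  have hφd : Differentiable ℂ (fun z => φ z ^ (2 * m)) := by
    simp only [hφ]; fun_prop
  have hbd := norm_le_mul_of_sphere_off_point (E := fun z => φ z ^ (2 * m) * E z) (ζ₀ := ζ₀)
    (K := K) (ε := ε / 2) (hφd.diffContOnCl.smul hE) ?_ hζ₀ (by positivity) ?_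
  · have hc : Tendsto (fun z => ‖φ z ^ (2 * m)‖) (𝓝 ζ₀) (𝓝 1) := by
      have := (hφd.continuous.norm).tendsto ζ₀
      convert this using 2
      simp [hφ, ← two_mul, hζne]
    have hev := hc.eventually_const_lt (show (1 / 2 : ℝ) < 1 by norm_num)
    obtain ⟨δ, hδ, hδ'⟩ := Metric.eventually_nhds_iff.1 hev
    refine ⟨δ, hδ, fun z hz hzδ => ?_⟩
    have h1 := hδ' (y := z) (by rwa [dist_eq_norm])
    have h2 := hbd z hz
    rw [norm_mul] at h2
    nlinarith [norm_nonneg (E z)]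
  · intro z hz
    rw [norm_mul, norm_pow]
    refine le_trans ?_ (hK z hz)
    exact mul_le_of_le_one_left (norm_nonneg _) (pow_le_one₀ (norm_nonneg _) (hφ1 z hz))
  · intro z hz
    have hzc := sphere_subset_closedBall hz
    rw [norm_mul, norm_pow]
    rcases lt_or_ge ‖z - ζ₀‖ ρ with h | h
    · exact (mul_le_of_le_one_left (norm_nonneg _)
        (pow_le_one₀ (norm_nonneg _) (hφ1 z hzc))).trans (hs z hz h)
    · have hsq : ‖φ z‖ ^ 2 ≤ κ := by
        rw [hφ, peak_norm_sq hζ₀ (mem_sphere_zero_iff_norm.1 hz)]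
        refine le_trans ?_ (le_max_right _ _)
        nlinarith
      rw [pow_mul]
      calc (‖φ z‖ ^ 2) ^ m * ‖E z‖ ≤ κ ^ m * (|K| * ‖z - ζ₀‖) := by
            gcongr
            exact (hK z hzc).trans (by gcongr; exact le_abs_self K)
        _ = |K| * κ ^ m * ‖z - ζ₀‖ := by ring
        _ ≤ ε / 2 * ‖z - ζ₀‖ := by gcongr

theorem exists_radial_limit_of_differentiableAt {G g : ℂ → ℂ} {K : NNReal} {θ₀ : ℝ}
    (hG : LipschitzWith K G) (hg : ∀ z ∈ ball (0 : ℂ) 1, HasDerivAt G (g z) z)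
    (hd : DifferentiableAt ℝ (fun θ : ℝ => G (exp (θ * I))) θ₀) :
    ∃ c, Tendsto (fun r : ℝ => g (r * exp (θ₀ * I))) (𝓝[<] 1) (𝓝 c) := by
  set ζ₀ := exp (θ₀ * I) with hζ₀
  have hζn : ‖ζ₀‖ = 1 := norm_exp_ofReal_mul_I θ₀
  have hζne : ζ₀ ≠ 0 := exp_ne_zero _
  set c : ℂ := deriv (fun θ : ℝ => G (exp (θ * I))) θ₀ / (ζ₀ * I) with hc
  set E : ℂ → ℂ := fun z => G z - G ζ₀ - c * (z - ζ₀) with hE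
  have hEderiv (z) (hz : z ∈ ball (0 : ℂ) 1) : HasDerivAt E (g z - c) z := by
    exact (((hg z hz).sub_const (G ζ₀)).fun_sub
      (((hasDerivAt_id' z).sub_const ζ₀).const_mul c)).congr_deriv (by rw [mul_one])
  have hEd : DiffContOnCl ℂ E (ball 0 1) := by
    refine ⟨fun z hz => (hEderiv z hz).differentiableAt.differentiableWithinAt, ?_⟩
    have := hG.continuous
    fun_prop
  have hEK : ∀ z ∈ closedBall (0 : ℂ) 1, ‖E z‖ ≤ (K + ‖c‖) * ‖z - ζ₀‖ := by
    intro z _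
    calc ‖E z‖ ≤ ‖G z - G ζ₀‖ + ‖c * (z - ζ₀)‖ := norm_sub_le _ _
      _ ≤ K * ‖z - ζ₀‖ + ‖c‖ * ‖z - ζ₀‖ := by
        rw [norm_mul]; gcongr; exact hG.norm_sub_le z ζ₀
      _ = _ := by ring
  have hEs : ∀ ε > 0, ∃ ρ > 0, ∀ z ∈ sphere (0 : ℂ) 1, ‖z - ζ₀‖ < ρ → ‖E z‖ ≤ ε * ‖z - ζ₀‖ := by
    intro ε hε
    have hexp : HasDerivAt (fun θ : ℝ => exp (θ * I)) (ζ₀ * I) θ₀ := by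
      simpa using ((ofRealCLM.hasDerivAt (x := θ₀)).mul_const I).cexp
    have h0 : HasDerivAt (fun θ : ℝ => E (exp (θ * I))) 0 θ₀ := by
      refine ((hd.hasDerivAt.sub_const (G ζ₀)).fun_sub
        ((hexp.sub_const ζ₀).const_mul c)).congr_deriv ?_
      rw [hc, div_mul_cancel₀ _ (mul_ne_zero hζne I_ne_zero), sub_self]
    have hlo := (hasDerivAt_iff_isLittleO.1 h0).bound (show 0 < ε * (2 / Real.pi) by positivity)
    obtain ⟨δ, hδ, hδ'⟩ := Metric.eventually_nhds_iff.1 hlo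
    refine ⟨δ / (Real.pi / 2), by positivity, fun z hz hzρ => ?_⟩
    rw [mem_sphere_zero_iff_norm] at hz
    have hz0 : z ≠ 0 := by rintro rfl; simp at hz
    have hang : |(z / ζ₀).arg| ≤ Real.pi / 2 * ‖z - ζ₀‖ := by
      rw [← angle_eq_abs_arg hz0 hζne]
      exact angle_le_mul_norm_sub hz hζn
    have hval : exp ((θ₀ + (z / ζ₀).arg : ℝ) * I) = z := by
      have h1 := norm_mul_exp_arg_mul_I (z / ζ₀)
      rw [norm_div, hz, hζn] at h1
      push_cast
      rw [add_mul, exp_add, ← hζ₀]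
      simp only [div_one, ofReal_one, one_mul] at h1
      rw [h1]
      field_simp
    have := hδ' (y := θ₀ + (z / ζ₀).arg) (by
      rw [Real.dist_eq, add_sub_cancel_left]
      rw [lt_div_iff₀ (by positivity)] at hzρ
      linarith)
    rw [hval] at this
    simp only [← hζ₀, add_sub_cancel_left, Real.norm_eq_abs] at this
    have hE0 : E ζ₀ = 0 := by simp [hE]
    rw [hE0] at this
    simp only [smul_zero, sub_zero] at this
    calc ‖E z‖ ≤ ε * (2 / Real.pi) * |(z / ζ₀).arg| := this
      _ ≤ ε * (2 / Real.pi) * (Real.pi / 2 * ‖z - ζ₀‖) := by gcongr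
      _ = ε * ‖z - ζ₀‖ := by field_simp
  have hnear := norm_le_mul_near_of_sphere hEd hEK hζn hEs
  refine ⟨c, Metric.tendsto_nhdsWithin_nhds.2 fun ε hε => ?_⟩
  obtain ⟨ρ, hρ, hρ'⟩ := hnear (ε / 6) (by positivity)
  refine ⟨min (ρ / 2) 1, by positivity, fun {r} hr hrd => ?_⟩
  rw [mem_Iio] at hr
  rw [Real.dist_eq, abs_sub_comm, abs_of_pos (by linarith), lt_min_iff] at hrd
  have hrn : ‖(r : ℂ) * ζ₀‖ = r := by
    rw [norm_mul, hζn, mul_one, Complex.norm_of_nonneg (by linarith)]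
  have hrz : ‖(r : ℂ) * ζ₀ - ζ₀‖ = 1 - r := by
    rw [← sub_one_mul, norm_mul, hζn, mul_one, norm_sub_rev, ← ofReal_one, ← ofReal_sub,
      Complex.norm_of_nonneg (by linarith)]
  have hsub : closedBall ((r : ℂ) * ζ₀) ((1 - r) / 2) ⊆ ball 0 1 := by
    intro w hw
    rw [mem_closedBall, dist_eq_norm] at hw
    rw [mem_ball_zero_iff]
    have := norm_add_le (w - r * ζ₀) (r * ζ₀)
    rw [sub_add_cancel] at this
    linarith
  have hder := Complex.norm_deriv_le_of_forall_mem_sphere_norm_le (f := E)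
    (c := (r : ℂ) * ζ₀) (R := (1 - r) / 2) (C := ε / 6 * (3 * (1 - r) / 2)) (by linarith) ?_ ?_
  · rw [(hEderiv _ (hsub (mem_closedBall_self (by linarith)))).deriv] at hder
    rw [dist_eq_norm]
    refine hder.trans_lt ?_
    rw [div_lt_iff₀ (by linarith)]
    nlinarith
  · exact (hEd.differentiableOn.mono hsub).diffContOnCl_ball le_rfl
  · intro w hw
    have hw1 := hsub (sphere_subset_closedBall hw)
    rw [mem_sphere, dist_eq_norm] at hw
    have h3 : ‖w - ζ₀‖ ≤ 3 * (1 - r) / 2 := by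
      have := norm_add_le (w - r * ζ₀) (r * ζ₀ - ζ₀)
      rw [sub_add_sub_cancel] at this
      linarith
    exact (hρ' w hw1 (by linarith)).trans (by gcongr)

/-- **Fatou's theorem** for bounded holomorphic functions on the unit disk. -/
theorem ae_exists_radial_limit {g : ℂ → ℂ} (hg : HoloDisk g) (hb : BoundedOnDisk g) :
    ∀ᵐ θ : ℝ, ∃ c, Tendsto (fun r : ℝ => g (r * exp (θ * I))) (𝓝[<] 1) (𝓝 c) := by
  obtain ⟨M, hM⟩ := hb
  obtain ⟨G₀, hG₀⟩ := DifferentiableOn.isExactOn_ball hg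
  have hM0 : 0 ≤ M := (norm_nonneg _).trans (hM 0 (by simp [unitDisk]))
  lift M to NNReal using hM0
  have hlip : LipschitzOnWith M G₀ (ball 0 1) :=
    (convex_ball 0 1).lipschitzOnWith_of_nnnorm_hasDerivWithin_le
      (fun z hz => (hG₀ z hz).hasDerivWithinAt) (fun z hz => hM z hz)
  obtain ⟨G, hG, hGeq⟩ := hlip.extend_finite_dimension
  have hGd : ∀ z ∈ ball (0 : ℂ) 1, HasDerivAt G (g z) z := fun z hz =>
    (hG₀ z hz).congr_of_eventuallyEq (hGeq.eventuallyEq_of_mem (isOpen_ball.mem_nhds hz)).symm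
  have hexp : LipschitzWith 1 (fun θ : ℝ => exp (θ * I)) := by
    refine lipschitzWith_of_nnnorm_deriv_le (by fun_prop) fun θ => ?_
    have : HasDerivAt (fun θ : ℝ => exp (θ * I)) (exp (θ * I) * I) θ := by
      simpa using ((ofRealCLM.hasDerivAt (x := θ)).mul_const I).cexp
    rw [this.deriv, ← NNReal.coe_le_coe]
    simp
  filter_upwards [(hG.comp hexp).ae_differentiableAt] with θ hθ
  exact exists_radial_limit_of_differentiableAt hG hGd hθ

section BoundaryValues

variable {E : Type*} [NormedAddCommGroup E]

/-- Lebesgue measure on an interval of angles parametrizing the unit circle once. -/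
abbrev arc : Measure ℝ := volume.restrict (Set.Ioc (0 : ℝ) (2 * Real.pi))

/-- The radial limit of `f` exists at the boundary point of angle `θ`. -/
def HasBdry (f : ℂ → E) (θ : ℝ) : Prop :=
  Tendsto (fun r : ℝ => f (r * exp (θ * I))) (𝓝[<] 1) (𝓝 (bdryMap f θ))

theorem bdryMap_eq_of_tendsto {f : ℂ → E} {θ : ℝ} {c : E}
    (h : Tendsto (fun r : ℝ => f (r * exp (θ * I))) (𝓝[<] 1) (𝓝 c)) : bdryMap f θ = c := by
  have hex : ∃ w, Tendsto (fun r : ℝ => f (r * exp (θ * I))) (𝓝[<] 1) (𝓝 w) := ⟨c, h⟩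
  rw [bdryMap, radialLimit, dif_pos hex]
  exact tendsto_nhds_unique hex.choose_spec h

theorem hasBdry_of_tendsto {f : ℂ → E} {θ : ℝ} {c : E}
    (h : Tendsto (fun r : ℝ => f (r * exp (θ * I))) (𝓝[<] 1) (𝓝 c)) : HasBdry f θ := by
  rwa [HasBdry, bdryMap_eq_of_tendsto h]

theorem HasBdry.comp_left {F : Type*} [NormedAddCommGroup F] {f : ℂ → E} {g : E → F} {θ : ℝ}
    (h : HasBdry f θ) (hg : ContinuousAt g (bdryMap f θ)) :
    Tendsto (fun r : ℝ => g (f (r * exp (θ * I)))) (𝓝[<] 1) (𝓝 (g (bdryMap f θ))) :=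
  hg.tendsto.comp h

theorem HasBdry.bdryMap_comp_left {F : Type*} [NormedAddCommGroup F] {f : ℂ → E} {g : E → F}
    {θ : ℝ} (h : HasBdry f θ) (hg : ContinuousAt g (bdryMap f θ)) :
    bdryMap (fun z => g (f z)) θ = g (bdryMap f θ) :=
  bdryMap_eq_of_tendsto (h.comp_left hg)

theorem norm_ray (r θ : ℝ) : ‖(r : ℂ) * exp (θ * I)‖ = |r| := by
  rw [norm_mul, norm_exp_ofReal_mul_I, mul_one, Complex.norm_real, Real.norm_eq_abs]

theorem ray_mem_unitDisk {r : ℝ} (θ : ℝ) (h : r ∈ Set.Ioo (0 : ℝ) 1) :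
    (r : ℂ) * exp (θ * I) ∈ unitDisk := by
  rw [unitDisk, mem_ball_zero_iff, norm_ray, abs_of_pos h.1]
  exact h.2

theorem Ioo_mem_nhdsLT_one : Set.Ioo (0 : ℝ) 1 ∈ 𝓝[<] (1 : ℝ) := Ioo_mem_nhdsLT one_pos

theorem eventually_ray_mem_unitDisk (θ : ℝ) :
    ∀ᶠ r : ℝ in 𝓝[<] 1, (r : ℂ) * exp (θ * I) ∈ unitDisk := by
  filter_upwards [Ioo_mem_nhdsLT_one] with r hr using ray_mem_unitDisk θ hr

theorem bdryMap_congr {f g : ℂ → E} (h : EqOn f g unitDisk) : bdryMap f = bdryMap g := by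
  ext θ
  have hev : (fun r : ℝ => f (r * exp (θ * I))) =ᶠ[𝓝[<] 1] fun r : ℝ => g (r * exp (θ * I)) := by
    filter_upwards [eventually_ray_mem_unitDisk θ] with r hr using h hr
  by_cases hex : ∃ w, Tendsto (fun r : ℝ => f (r * exp (θ * I))) (𝓝[<] 1) (𝓝 w)
  · obtain ⟨w, hw⟩ := hex
    rw [bdryMap_eq_of_tendsto hw, bdryMap_eq_of_tendsto (hw.congr' hev)]
  · rw [bdryMap, radialLimit, dif_neg hex, bdryMap, radialLimit, dif_neg]
    exact fun ⟨w, hw⟩ => hex ⟨w, hw.congr' hev.symm⟩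

theorem HasBdry.norm_le {f : ℂ → E} {θ M : ℝ} (h : HasBdry f θ) (hM : ∀ z ∈ unitDisk, ‖f z‖ ≤ M) :
    ‖bdryMap f θ‖ ≤ M := by
  refine le_of_tendsto h.norm ?_
  filter_upwards [eventually_ray_mem_unitDisk θ] with r hr using hM _ hr

theorem HoloDisk.continuous_ray [NormedSpace ℂ E] {f : ℂ → E} (hf : HoloDisk f) {r : ℝ}
    (hr : r ∈ Set.Ioo (0 : ℝ) 1) : Continuous fun θ : ℝ => f (r * exp (θ * I)) :=
  hf.continuousOn.comp_continuous (by fun_prop) fun θ => ray_mem_unitDisk θ hr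

theorem aestronglyMeasurable_bdryMap [NormedSpace ℂ E] {f : ℂ → E} (hf : HoloDisk f)
    (h : ∀ᵐ θ ∂arc, HasBdry f θ) : AEStronglyMeasurable (bdryMap f) arc := by
  obtain ⟨u, hu⟩ := exists_seq_tendsto (𝓝[<] (1 : ℝ))
  obtain ⟨N, hN⟩ := eventually_atTop.1 (hu.eventually Ioo_mem_nhdsLT_one)
  refine aestronglyMeasurable_of_tendsto_ae atTop
    (f := fun n (θ : ℝ) => f ((u (n + N) : ℝ) * exp (θ * I)))
    (fun n => (hf.continuous_ray (hN _ (Nat.le_add_left _ _))).aestronglyMeasurable) ?_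
  filter_upwards [h] with θ hθ
  exact hθ.comp (hu.comp (tendsto_add_atTop_nat N))

theorem ae_hasBdry {g : ℂ → ℂ} (hg : HoloDisk g) (hb : BoundedOnDisk g) :
    ∀ᵐ θ ∂arc, HasBdry g θ := by
  filter_upwards [ae_restrict_of_ae (ae_exists_radial_limit hg hb)] with θ hθ
  exact hasBdry_of_tendsto hθ.choose_spec

end BoundaryValues

theorem zero_mem_unitDisk : (0 : ℂ) ∈ unitDisk := by simp [unitDisk]

/-- The squared `L²` norm of `g` on the circle of radius `r` (not normalized). -/
def radialNormSq (g : ℂ → ℂ) (r : ℝ) : ℝ := ∫ θ, ‖g (r * exp (θ * I))‖ ^ 2 ∂arc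

/-- The squared `L²` norm of the boundary values of `g` (not normalized). -/
def bdryNormSq (g : ℂ → ℂ) : ℝ := ∫ θ, ‖bdryMap g θ‖ ^ 2 ∂arc

theorem integrable_bdry_normSq {g : ℂ → ℂ} (hg : HoloDisk g) (hb : BoundedOnDisk g) :
    Integrable (fun θ => ‖bdryMap g θ‖ ^ 2) arc := by
  obtain ⟨M, hM⟩ := hb
  have hae := ae_hasBdry hg ⟨M, hM⟩
  refine Integrable.of_bound ((aestronglyMeasurable_bdryMap hg hae).norm.pow 2) (M ^ 2) ?_
  filter_upwards [hae] with θ hθ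
  rw [norm_pow, norm_norm]
  gcongr
  exact hθ.norm_le hM

theorem tendsto_radialNormSq {g : ℂ → ℂ} (hg : HoloDisk g) (hb : BoundedOnDisk g) :
    Tendsto (radialNormSq g) (𝓝[<] 1) (𝓝 (bdryNormSq g)) := by
  have hae := ae_hasBdry hg hb
  obtain ⟨M, hM⟩ := hb
  refine tendsto_integral_filter_of_dominated_convergence (fun _ => M ^ 2) ?_ ?_
    (integrable_const _) ?_
  · filter_upwards [Ioo_mem_nhdsLT_one] with r hr
    exact ((hg.continuous_ray hr).norm.pow 2).aestronglyMeasurable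
  · filter_upwards [Ioo_mem_nhdsLT_one] with r hr
    refine Eventually.of_forall fun θ => ?_
    rw [norm_pow, norm_norm]
    gcongr
    exact hM _ (ray_mem_unitDisk θ hr)
  · filter_upwards [hae] with θ hθ using hθ.norm.pow 2

theorem integral_ray_eq {g : ℂ → ℂ} (hg : HoloDisk g) {r : ℝ} (hr : r ∈ Set.Ioo (0 : ℝ) 1) :
    ∫ θ, g (r * exp (θ * I)) ∂arc = 2 * Real.pi * g 0 := by
  have hsub : closedBall (0 : ℂ) |r| ⊆ unitDisk := by
    rw [abs_of_pos hr.1]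
    exact closedBall_subset_ball hr.2
  have h := ((hg.mono hsub).diffContOnCl_ball le_rfl).circleAverage
  rw [Real.circleAverage_def, intervalIntegral.integral_of_le Real.two_pi_pos.le] at h
  simp only [circleMap, zero_add] at h
  rw [← h, Complex.real_smul, arc]
  push_cast
  rw [← mul_assoc, mul_inv_cancel₀ (by simp), one_mul]

theorem radialNormSq_const_add {p : ℂ → ℂ} (hp : HoloDisk p) (hp0 : p 0 = 0) (a : ℂ) {r : ℝ}
    (hr : r ∈ Set.Ioo (0 : ℝ) 1) :
    radialNormSq (fun z => a + p z) r = 2 * Real.pi * ‖a‖ ^ 2 + radialNormSq p r := by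
  have hc := hp.continuous_ray hr
  have hint {u : ℝ → ℝ} (hu : Continuous u) : Integrable u arc :=
    (hu.integrableOn_Icc).mono_set Ioc_subset_Icc_self
  have hmean := integral_ray_eq (g := fun z => (starRingEnd ℂ) a * p z)
    (hp.const_mul ((starRingEnd ℂ) a)) hr
  have hre : ∫ θ, ((starRingEnd ℂ) a * p (r * exp (θ * I))).re ∂arc = 0 := by
    have hi : Integrable (fun θ : ℝ => (starRingEnd ℂ) a * p (r * exp (θ * I))) arc :=
      ((continuous_const.mul hc).integrableOn_Icc).mono_set Ioc_subset_Icc_self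
    have := integral_re hi
    simp only [RCLike.re_to_complex] at this
    rw [this, hmean, hp0]
    simp
  have hpt (θ : ℝ) : ‖a + p (r * exp (θ * I))‖ ^ 2 = ‖a‖ ^ 2 + ‖p (r * exp (θ * I))‖ ^ 2
      + 2 * ((starRingEnd ℂ) a * p (r * exp (θ * I))).re := by
    simp only [← Complex.normSq_eq_norm_sq, Complex.normSq_apply, add_re, add_im, mul_re, conj_re,
      conj_im]
    ring
  simp only [radialNormSq, hpt]
  have hn : Continuous fun θ : ℝ => ‖p (r * exp (θ * I))‖ ^ 2 := hc.norm.pow 2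
  have hcr : Continuous fun θ : ℝ => 2 * ((starRingEnd ℂ) a * p (r * exp (θ * I))).re :=
    continuous_const.mul (Complex.continuous_re.comp (continuous_const.mul hc))
  rw [integral_add (hint (hn.const_add _)) (hint hcr),
    integral_add (hint continuous_const) (hint hn), integral_const_mul, hre]
  simp [Measure.real, Real.pi_nonneg]

theorem bdryNormSq_const_add {p : ℂ → ℂ} (hp : HoloDisk p) (hb : BoundedOnDisk p)
    (hp0 : p 0 = 0) (a : ℂ) :
    bdryNormSq (fun z => a + p z) = 2 * Real.pi * ‖a‖ ^ 2 + bdryNormSq p := by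
  have hb' : BoundedOnDisk fun z => a + p z := by
    obtain ⟨M, hM⟩ := hb
    exact ⟨‖a‖ + M, fun z hz => (norm_add_le _ _).trans (by gcongr; exact hM z hz)⟩
  have hp' : HoloDisk fun z => a + p z := hp.const_add a
  refine tendsto_nhds_unique (tendsto_radialNormSq hp' hb') ?_
  refine ((tendsto_radialNormSq hp hb).const_add (2 * Real.pi * ‖a‖ ^ 2)).congr' ?_
  filter_upwards [Ioo_mem_nhdsLT_one] with r hr
  exact (radialNormSq_const_add hp hp0 a hr).symm

/-- The power series with coefficients `a`. -/
def powerSum (a : ℕ → ℂ) (z : ℂ) : ℂ := ∑' k, a k * z ^ k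

theorem norm_lt_one_of_mem {z : ℂ} (hz : z ∈ unitDisk) : ‖z‖ < 1 := mem_ball_zero_iff.1 hz

section PowerSum

variable {a : ℕ → ℂ} {A : ℝ} (ha : ∀ k, ‖a k‖ ≤ A)

include ha

theorem norm_powerSum_term_le (k : ℕ) (z : ℂ) : ‖a k * z ^ k‖ ≤ A * ‖z‖ ^ k := by
  rw [norm_mul, norm_pow]
  gcongr
  exact ha k

theorem summable_powerSum {z : ℂ} (hz : z ∈ unitDisk) : Summable fun k => a k * z ^ k :=
  Summable.of_norm_bounded
    ((summable_geometric_of_lt_one (norm_nonneg _) (norm_lt_one_of_mem hz)).mul_left A)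
    fun k => norm_powerSum_term_le ha k z

theorem powerSum_eq {z : ℂ} (hz : z ∈ unitDisk) :
    powerSum a z = a 0 + z * powerSum (fun k => a (k + 1)) z := by
  rw [powerSum, (summable_powerSum ha hz).tsum_eq_zero_add, powerSum, ← tsum_mul_left]
  simp only [pow_zero, mul_one]
  congr 2
  ext k
  ring

theorem norm_powerSum_le {z : ℂ} (hz : z ∈ unitDisk) : ‖powerSum a z‖ ≤ A / (1 - ‖z‖) :=
  tsum_of_norm_bounded
    ((hasSum_geometric_of_lt_one (norm_nonneg _) (norm_lt_one_of_mem hz)).mul_left A)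
    fun k => norm_powerSum_term_le ha k z

theorem holoDisk_powerSum : HoloDisk (powerSum a) := by
  have hA : 0 ≤ A := (norm_nonneg _).trans (ha 0)
  intro z hz
  obtain ⟨ρ, hzρ, hρ⟩ := exists_between (norm_lt_one_of_mem hz)
  have hd : DifferentiableOn ℂ (powerSum a) (ball 0 ρ) := by
    refine Complex.differentiableOn_tsum_of_summable_norm
      ((summable_geometric_of_lt_one ((norm_nonneg z).trans hzρ.le) hρ).mul_left A)
      (fun k => by fun_prop) isOpen_ball fun k w hw => ?_
    refine (norm_powerSum_term_le ha k w).trans ?_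
    gcongr
    exact (mem_ball_zero_iff.1 hw).le
  exact (hd.differentiableAt (isOpen_ball.mem_nhds (mem_ball_zero_iff.2 hzρ))).differentiableWithinAt

theorem boundedOnDisk_powerSum_succ (hb : BoundedOnDisk (powerSum a)) :
    BoundedOnDisk (powerSum fun k => a (k + 1)) := by
  obtain ⟨M, hM⟩ := hb
  have hA : 0 ≤ A := (norm_nonneg _).trans (ha 0)
  have hM0 : 0 ≤ M := (norm_nonneg _).trans (hM 0 zero_mem_unitDisk)
  refine ⟨2 * (M + A), fun z hz => ?_⟩
  rcases le_or_gt ‖z‖ (1 / 2) with h | h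
  · refine (norm_powerSum_le (fun k => ha (k + 1)) hz).trans ?_
    rw [div_le_iff₀ (by linarith)]
    nlinarith
  · have h1 : z * powerSum (fun k => a (k + 1)) z = powerSum a z - a 0 := by
      rw [powerSum_eq ha hz]; ring
    have h2 := congrArg norm h1
    rw [norm_mul] at h2
    have h3 := norm_sub_le (powerSum a z) (a 0)
    nlinarith [hM z hz, ha 0, norm_nonneg (powerSum (fun k => a (k + 1)) z)]

end PowerSum

theorem exists_powerSum_eqOn {F : ℂ → ℂ} (hF : HoloDisk F) (hb : BoundedOnDisk F) :
    ∃ (a : ℕ → ℂ) (A : ℝ), (∀ k, ‖a k‖ ≤ A) ∧ EqOn F (powerSum a) unitDisk := by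
  obtain ⟨M, hM⟩ := hb
  refine ⟨fun k => (k.factorial : ℂ)⁻¹ * iteratedDeriv k F 0, M, fun k => ?_, fun z hz => ?_⟩
  · have hle : ∀ r ∈ Set.Ioo (0 : ℝ) 1,
        ‖(k.factorial : ℂ)⁻¹ * iteratedDeriv k F 0‖ * r ^ k ≤ M := by
      intro r hr
      have h := Complex.norm_iteratedDeriv_le_of_forall_mem_sphere_norm_le k hr.1
        (DifferentiableOn.diffContOnCl_ball (hF : DifferentiableOn ℂ F (ball 0 1))
          (closedBall_subset_ball hr.2))
        (fun z hz => hM z (closedBall_subset_ball hr.2 (sphere_subset_closedBall hz)))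
      rw [le_div_iff₀ (pow_pos hr.1 k)] at h
      rw [norm_mul, norm_inv, Complex.norm_natCast, mul_assoc, inv_mul_le_iff₀ (by positivity)]
      exact h
    have hc : Continuous fun r : ℝ => ‖(k.factorial : ℂ)⁻¹ * iteratedDeriv k F 0‖ * r ^ k := by
      fun_prop
    have ht := (hc.tendsto 1).mono_left (nhdsWithin_le_nhds (s := Set.Iio 1))
    simp only [one_pow, mul_one] at ht
    refine le_of_tendsto ht ?_
    filter_upwards [Ioo_mem_nhdsLT_one] with r hr using hle r hr
  · have := Complex.taylorSeries_eq_on_ball' hz hF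
    simp only [sub_zero] at this
    rw [← this, powerSum]

theorem HoloDisk.comp_self {E : Type*} [NormedAddCommGroup E] [NormedSpace ℂ E] {g : ℂ → E}
    {h : ℂ → ℂ} (hg : HoloDisk g) (hh : HoloDisk h) (hhU : ∀ ζ ∈ unitDisk, h ζ ∈ unitDisk) :
    HoloDisk (g ∘ h) :=
  DifferentiableOn.comp hg hh hhU

theorem BoundedOnDisk.comp_self {E : Type*} [NormedAddCommGroup E] {g : ℂ → E} {h : ℂ → ℂ}
    (hg : BoundedOnDisk g) (hhU : ∀ ζ ∈ unitDisk, h ζ ∈ unitDisk) : BoundedOnDisk (g ∘ h) :=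
  hg.imp fun _ hM z hz => hM _ (hhU z hz)

theorem HoloDisk.mul {g h : ℂ → ℂ} (hg : HoloDisk g) (hh : HoloDisk h) :
    HoloDisk fun z => g z * h z :=
  DifferentiableOn.fun_mul hg hh

theorem BoundedOnDisk.mul {g h : ℂ → ℂ} (hg : BoundedOnDisk g) (hh : BoundedOnDisk h) :
    BoundedOnDisk fun z => g z * h z := by
  obtain ⟨M, hM⟩ := hg
  obtain ⟨N, hN⟩ := hh
  refine ⟨M * N, fun z hz => ?_⟩
  rw [norm_mul]
  exact mul_le_mul (hM z hz) (hN z hz) (norm_nonneg _) ((norm_nonneg _).trans (hM z hz))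

theorem radialNormSq_congr {f g : ℂ → ℂ} (h : EqOn f g unitDisk) {r : ℝ}
    (hr : r ∈ Set.Ioo (0 : ℝ) 1) : radialNormSq f r = radialNormSq g r := by
  simp only [radialNormSq, h (ray_mem_unitDisk _ hr)]

theorem bdryNormSq_congr {f g : ℂ → ℂ} (h : EqOn f g unitDisk) : bdryNormSq f = bdryNormSq g := by
  rw [bdryNormSq, bdryMap_congr h, bdryNormSq]

section Subordination

variable {h : ℂ → ℂ} (hh : HoloDisk h) (hhU : ∀ ζ ∈ unitDisk, h ζ ∈ unitDisk) (hh0 : h 0 = 0)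

include hh hhU hh0

theorem radialNormSq_comp_le_succ {a : ℕ → ℂ} {A : ℝ} (ha : ∀ k, ‖a k‖ ≤ A) {r : ℝ}
    (hr : r ∈ Set.Ioo (0 : ℝ) 1) :
    radialNormSq (powerSum a ∘ h) r ≤
      2 * Real.pi * ‖a 0‖ ^ 2 + radialNormSq (powerSum (fun k => a (k + 1)) ∘ h) r := by
  have hs := (holoDisk_powerSum fun k => ha (k + 1)).comp_self hh hhU
  have hp := HoloDisk.mul hh hs
  have heq : EqOn (powerSum a ∘ h)
      (fun z => a 0 + h z * (powerSum (fun k => a (k + 1)) ∘ h) z) unitDisk :=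
    fun z hz => powerSum_eq ha (hhU z hz)
  rw [radialNormSq_congr heq hr, radialNormSq_const_add hp (by simp [hh0]) _ hr]
  refine add_le_add le_rfl ?_
  have hcp := hp.continuous_ray hr
  have hcs := hs.continuous_ray hr
  refine integral_mono (((hcp.norm.pow 2).integrableOn_Icc).mono_set Ioc_subset_Icc_self)
    (((hcs.norm.pow 2).integrableOn_Icc).mono_set Ioc_subset_Icc_self) fun θ => ?_
  dsimp only
  rw [norm_mul, mul_pow]
  exact mul_le_of_le_one_left (by positivity) (pow_le_one₀ (norm_nonneg _)
    (norm_lt_one_of_mem (hhU _ (ray_mem_unitDisk θ hr))).le)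

theorem radialNormSq_comp_le_sum {a : ℕ → ℂ} {A : ℝ} (ha : ∀ k, ‖a k‖ ≤ A) {r : ℝ}
    (hr : r ∈ Set.Ioo (0 : ℝ) 1) (N : ℕ) :
    radialNormSq (powerSum a ∘ h) r ≤ 2 * Real.pi * ∑ k ∈ Finset.range N, ‖a k‖ ^ 2 +
      radialNormSq (powerSum (fun k => a (k + N)) ∘ h) r := by
  induction N with
  | zero => simp
  | succ N ih =>
    have := radialNormSq_comp_le_succ hh hhU hh0 (fun k => ha (k + N)) hr
    simp only [zero_add, add_right_comm _ 1 N] at this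
    rw [Finset.sum_range_succ, mul_add]
    simp only [← add_assoc]
    simp only [add_right_comm _ N 1] at this ⊢
    linarith

/-- **Littlewood's subordination inequality** on circles inside the disk. -/
theorem radialNormSq_comp_le_tsum {a : ℕ → ℂ} (ha : Summable fun k => ‖a k‖ ^ 2) {r : ℝ}
    (hr : r ∈ Set.Ioo (0 : ℝ) 1) :
    radialNormSq (powerSum a ∘ h) r ≤ 2 * Real.pi * ∑' k, ‖a k‖ ^ 2 := by
  set t : ℕ → ℝ := fun N => ∑' k, ‖a (k + N)‖ ^ 2 with ht
  have htail (N k : ℕ) : ‖a (k + N)‖ ≤ √(t N) := by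
    refine Real.le_sqrt_of_sq_le ?_
    exact ((summable_nat_add_iff N).2 ha).le_tsum k fun _ _ => by positivity
  have hA : ∀ k, ‖a k‖ ≤ √(t 0) := htail 0
  have hlim : Tendsto t atTop (𝓝 0) := tendsto_sum_nat_add fun k => ‖a k‖ ^ 2
  have hbd (N : ℕ) : radialNormSq (powerSum (fun k => a (k + N)) ∘ h) r ≤
      2 * Real.pi * (t N / (1 - r) ^ 2) := by
    have hle (θ : ℝ) : ‖(powerSum (fun k => a (k + N)) ∘ h) (r * exp (θ * I))‖ ^ 2 ≤
        t N / (1 - r) ^ 2 := by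
      have hmem := ray_mem_unitDisk θ hr
      have h1 := norm_powerSum_le (htail N) (hhU _ hmem)
      have h2 : ‖h (r * exp (θ * I))‖ ≤ r := by
        have := Complex.norm_le_norm_of_mapsTo_ball (R := 1) hh
          (fun z hz => ball_subset_closedBall (hhU z hz)) hh0 (norm_lt_one_of_mem hmem)
        rwa [norm_ray, abs_of_pos hr.1] at this
      have h3 : √(t N) / (1 - ‖h (r * exp (θ * I))‖) ≤ √(t N) / (1 - r) := by
        have := hr.2
        gcongr
      calc _ ≤ (√(t N) / (1 - r)) ^ 2 := by gcongr; exact h1.trans h3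
        _ = _ := by rw [div_pow, Real.sq_sqrt]; exact tsum_nonneg fun _ => by positivity
    have hs := (holoDisk_powerSum (htail N)).comp_self hh hhU
    have hint : Integrable
        (fun θ : ℝ => ‖(powerSum (fun k => a (k + N)) ∘ h) (r * exp (θ * I))‖ ^ 2) arc :=
      (((hs.continuous_ray hr).norm.pow 2).integrableOn_Icc).mono_set Ioc_subset_Icc_self
    refine (integral_mono hint (integrable_const _) hle).trans_eq ?_
    simp [Measure.real, Real.pi_nonneg]
  refine ge_of_tendsto (x := atTop)
    (f := fun N => 2 * Real.pi * ∑' k, ‖a k‖ ^ 2 + 2 * Real.pi * (t N / (1 - r) ^ 2)) ?_ ?_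
  · have := ((hlim.div_const ((1 - r) ^ 2)).const_mul (2 * Real.pi)).const_add
      (2 * Real.pi * ∑' k, ‖a k‖ ^ 2)
    simpa using this
  · refine Eventually.of_forall fun N => ?_
    refine (radialNormSq_comp_le_sum hh hhU hh0 hA hr N).trans ?_
    gcongr
    · exact ha.sum_le_tsum _ fun _ _ => by positivity
    · exact hbd N

theorem bdryNormSq_comp_le_tsum {a : ℕ → ℂ} {A : ℝ} (hA : ∀ k, ‖a k‖ ≤ A)
    (hb : BoundedOnDisk (powerSum a)) (ha : Summable fun k => ‖a k‖ ^ 2) :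
    bdryNormSq (powerSum a ∘ h) ≤ 2 * Real.pi * ∑' k, ‖a k‖ ^ 2 := by
  refine le_of_tendsto (tendsto_radialNormSq ((holoDisk_powerSum hA).comp_self hh hhU)
    (hb.comp_self hhU)) ?_
  filter_upwards [Ioo_mem_nhdsLT_one] with r hr
  exact radialNormSq_comp_le_tsum hh hhU hh0 ha hr

theorem bdryNormSq_comp_eq_succ {a : ℕ → ℂ} {A : ℝ} (ha : ∀ k, ‖a k‖ ≤ A)
    (hb : BoundedOnDisk (powerSum a)) :
    bdryNormSq (powerSum a ∘ h) = 2 * Real.pi * ‖a 0‖ ^ 2 +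
      ∫ θ, ‖bdryMap h θ‖ ^ 2 * ‖bdryMap (powerSum (fun k => a (k + 1)) ∘ h) θ‖ ^ 2 ∂arc := by
  have hs := (holoDisk_powerSum fun k => ha (k + 1)).comp_self hh hhU
  have hsb := (boundedOnDisk_powerSum_succ ha hb).comp_self hhU
  have hhb : BoundedOnDisk h := ⟨1, fun z hz => (norm_lt_one_of_mem (hhU z hz)).le⟩
  have heq : EqOn (powerSum a ∘ h)
      (fun z => a 0 + h z * (powerSum (fun k => a (k + 1)) ∘ h) z) unitDisk :=
    fun z hz => powerSum_eq ha (hhU z hz)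
  rw [bdryNormSq_congr heq, bdryNormSq_const_add (HoloDisk.mul hh hs) (BoundedOnDisk.mul hhb hsb) (by simp [hh0])]
  congr 1
  refine integral_congr_ae ?_
  filter_upwards [ae_hasBdry hh hhb, ae_hasBdry hs hsb] with θ h1 h2
  rw [← mul_pow, ← norm_mul]
  congr 2
  exact bdryMap_eq_of_tendsto (h1.mul h2)

end Subordination

theorem boundedOnDisk_powerSum_add {a : ℕ → ℂ} {A : ℝ} (ha : ∀ k, ‖a k‖ ≤ A)
    (hb : BoundedOnDisk (powerSum a)) (N : ℕ) : BoundedOnDisk (powerSum fun k => a (k + N)) := by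
  induction N with
  | zero => exact hb
  | succ N ih =>
    have := boundedOnDisk_powerSum_succ (fun k => ha (k + N)) ih
    simpa only [add_right_comm _ 1 N, ← add_assoc] using this

section InnerFunction

variable {h : ℂ → ℂ} (hh : HoloDisk h) (hhU : ∀ ζ ∈ unitDisk, h ζ ∈ unitDisk) (hh0 : h 0 = 0)
  (hin : ∀ᵐ θ ∂arc, ‖bdryMap h θ‖ = 1)

include hh hhU hh0 hin

theorem bdryNormSq_comp_inner_succ {a : ℕ → ℂ} {A : ℝ} (ha : ∀ k, ‖a k‖ ≤ A)
    (hb : BoundedOnDisk (powerSum a)) :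
    bdryNormSq (powerSum a ∘ h) =
      2 * Real.pi * ‖a 0‖ ^ 2 + bdryNormSq (powerSum (fun k => a (k + 1)) ∘ h) := by
  rw [bdryNormSq_comp_eq_succ hh hhU hh0 ha hb]
  congr 1
  refine integral_congr_ae ?_
  filter_upwards [hin] with θ hθ
  rw [hθ, one_pow, one_mul]

theorem bdryNormSq_comp_inner_sum {a : ℕ → ℂ} {A : ℝ} (ha : ∀ k, ‖a k‖ ≤ A)
    (hb : BoundedOnDisk (powerSum a)) (N : ℕ) :
    bdryNormSq (powerSum a ∘ h) = 2 * Real.pi * ∑ k ∈ Finset.range N, ‖a k‖ ^ 2 +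
      bdryNormSq (powerSum (fun k => a (k + N)) ∘ h) := by
  induction N with
  | zero => simp
  | succ N ih =>
    have := bdryNormSq_comp_inner_succ hh hhU hh0 hin (fun k => ha (k + N))
      (boundedOnDisk_powerSum_add ha hb N)
    simp only [zero_add, add_right_comm _ 1 N] at this
    rw [ih, this, Finset.sum_range_succ, mul_add, add_assoc]
    rfl

end InnerFunction

theorem bdryNormSq_nonneg (g : ℂ → ℂ) : 0 ≤ bdryNormSq g :=
  integral_nonneg fun _ => by positivity

theorem holoDisk_id : HoloDisk id := differentiableOn_id

theorem norm_bdryMap_id (θ : ℝ) : ‖bdryMap (id : ℂ → ℂ) θ‖ = 1 := by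
  have hc : Continuous fun r : ℝ => (r : ℂ) * exp (θ * I) := by fun_prop
  rw [bdryMap_eq_of_tendsto (f := id) ((hc.tendsto 1).mono_left nhdsWithin_le_nhds), norm_ray,
    abs_one]

/-- The coefficients of a bounded power series on the disk are square summable. -/
theorem summable_normSq_of_bounded {a : ℕ → ℂ} {A : ℝ} (ha : ∀ k, ‖a k‖ ≤ A)
    (hb : BoundedOnDisk (powerSum a)) : Summable fun k => ‖a k‖ ^ 2 := by
  refine summable_of_sum_range_le (c := bdryNormSq (powerSum a ∘ id) / (2 * Real.pi))
    (fun _ => by positivity) fun N => ?_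
  rw [le_div_iff₀ Real.two_pi_pos, bdryNormSq_comp_inner_sum holoDisk_id (fun _ hz => hz) rfl
    (Eventually.of_forall norm_bdryMap_id) ha hb N, mul_comm]
  exact le_add_of_nonneg_right (bdryNormSq_nonneg _)

theorem bdryNormSq_comp_inner_eq_tsum {h : ℂ → ℂ} (hh : HoloDisk h)
    (hhU : ∀ ζ ∈ unitDisk, h ζ ∈ unitDisk) (hh0 : h 0 = 0)
    (hin : ∀ᵐ θ ∂arc, ‖bdryMap h θ‖ = 1) {a : ℕ → ℂ} {A : ℝ} (ha : ∀ k, ‖a k‖ ≤ A)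
    (hb : BoundedOnDisk (powerSum a)) :
    bdryNormSq (powerSum a ∘ h) = 2 * Real.pi * ∑' k, ‖a k‖ ^ 2 := by
  have hs := summable_normSq_of_bounded ha hb
  have htail : Tendsto (fun N => bdryNormSq (powerSum (fun k => a (k + N)) ∘ h)) atTop (𝓝 0) := by
    have hlim := (tendsto_sum_nat_add fun k => ‖a k‖ ^ 2).const_mul (2 * Real.pi)
    rw [mul_zero] at hlim
    exact squeeze_zero (fun _ => bdryNormSq_nonneg _) (fun N => bdryNormSq_comp_le_tsum hh hhU hh0
      (fun k => ha (k + N)) (boundedOnDisk_powerSum_add ha hb N)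
      ((summable_nat_add_iff N).2 hs)) hlim
  refine tendsto_nhds_unique (tendsto_const_nhds (x := _) (f := atTop (α := ℕ))) ?_
  have := (hs.hasSum.tendsto_sum_nat.const_mul (2 * Real.pi)).add htail
  rw [add_zero] at this
  exact this.congr fun N => (bdryNormSq_comp_inner_sum hh hhU hh0 hin ha hb N).symm

theorem bdryNormSq_powerSum_eq_tsum {a : ℕ → ℂ} {A : ℝ} (ha : ∀ k, ‖a k‖ ≤ A)
    (hb : BoundedOnDisk (powerSum a)) :
    bdryNormSq (powerSum a) = 2 * Real.pi * ∑' k, ‖a k‖ ^ 2 :=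
  bdryNormSq_comp_inner_eq_tsum holoDisk_id (fun _ hz => hz) rfl
    (Eventually.of_forall norm_bdryMap_id) ha hb

theorem BoundedOnDisk.congr {f g : ℂ → ℂ} (hf : BoundedOnDisk f) (hfg : EqOn f g unitDisk) :
    BoundedOnDisk g :=
  hf.imp fun _ hM z hz => hfg hz ▸ hM z hz

/-- Composition with an inner function fixing the origin preserves the `H²` norm. -/
theorem bdryNormSq_comp_inner {h : ℂ → ℂ} (hh : HoloDisk h)
    (hhU : ∀ ζ ∈ unitDisk, h ζ ∈ unitDisk) (hh0 : h 0 = 0)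
    (hin : ∀ᵐ θ ∂arc, ‖bdryMap h θ‖ = 1) {F : ℂ → ℂ} (hF : HoloDisk F) (hb : BoundedOnDisk F) :
    bdryNormSq (F ∘ h) = bdryNormSq F := by
  obtain ⟨a, A, ha, hFa⟩ := exists_powerSum_eqOn hF hb
  have hba := hb.congr hFa
  rw [bdryNormSq_congr hFa, bdryNormSq_congr (f := F ∘ h) (g := powerSum a ∘ h) fun z hz => hFa (hhU z hz),
    bdryNormSq_comp_inner_eq_tsum hh hhU hh0 hin ha hba, bdryNormSq_powerSum_eq_tsum ha hba]

section Rigidity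

variable {h : ℂ → ℂ} (hh : HoloDisk h) (hhU : ∀ ζ ∈ unitDisk, h ζ ∈ unitDisk) (hh0 : h 0 = 0)

include hh hhU hh0

theorem ae_of_bdryNormSq_comp_eq_tsum {a : ℕ → ℂ} {A : ℝ} (ha : ∀ k, ‖a k‖ ≤ A)
    (hb : BoundedOnDisk (powerSum a))
    (heq : bdryNormSq (powerSum a ∘ h) = 2 * Real.pi * ∑' k, ‖a k‖ ^ 2) :
    (∀ᵐ θ ∂arc, ‖bdryMap h θ‖ = 1 ∨ bdryMap (powerSum (fun k => a (k + 1)) ∘ h) θ = 0) ∧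
      bdryNormSq (powerSum (fun k => a (k + 1)) ∘ h) =
        2 * Real.pi * ∑' k, ‖a (k + 1)‖ ^ 2 := by
  have hsum := summable_normSq_of_bounded ha hb
  have hb' := boundedOnDisk_powerSum_succ ha hb
  have hle := bdryNormSq_comp_le_tsum hh hhU hh0 (fun k => ha (k + 1)) hb'
    ((summable_nat_add_iff 1).2 hsum)
  have hs := (holoDisk_powerSum fun k => ha (k + 1)).comp_self hh hhU
  have hsb := hb'.comp_self hhU
  have hhb : BoundedOnDisk h := ⟨1, fun z hz => (norm_lt_one_of_mem (hhU z hz)).le⟩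
  rw [bdryNormSq_comp_eq_succ hh hhU hh0 ha hb, hsum.tsum_eq_zero_add, mul_add,
    add_left_cancel_iff] at heq
  have hi1 := integrable_bdry_normSq hs hsb
  have hnorm : ∀ᵐ θ ∂arc, ‖bdryMap h θ‖ ≤ 1 := by
    filter_upwards [ae_hasBdry hh hhb] with θ hθ
    exact hθ.norm_le fun z hz => (norm_lt_one_of_mem (hhU z hz)).le
  have hi2 : Integrable (fun θ => ‖bdryMap h θ‖ ^ 2 *
      ‖bdryMap (powerSum (fun k => a (k + 1)) ∘ h) θ‖ ^ 2) arc := by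
    refine hi1.bdd_mul (c := 1)
      ((aestronglyMeasurable_bdryMap hh (ae_hasBdry hh hhb)).norm.pow 2) ?_
    filter_upwards [hnorm] with θ hθ
    rw [norm_pow, norm_norm]
    exact pow_le_one₀ (norm_nonneg _) hθ
  have hpt : ∀ᵐ θ ∂arc, ‖bdryMap h θ‖ ^ 2 *
      ‖bdryMap (powerSum (fun k => a (k + 1)) ∘ h) θ‖ ^ 2 ≤
        ‖bdryMap (powerSum (fun k => a (k + 1)) ∘ h) θ‖ ^ 2 := by
    filter_upwards [hnorm] with θ hθ
    exact mul_le_of_le_one_left (by positivity) (pow_le_one₀ (norm_nonneg _) hθ)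
  have hge := integral_mono_ae hi2 hi1 hpt
  have hmain := hle.antisymm (heq ▸ hge)
  refine ⟨?_, hmain⟩
  have hae := (integral_eq_iff_of_ae_le hi2 hi1 hpt).1 (heq.trans hmain.symm)
  filter_upwards [hae] with θ hθ
  rw [or_iff_not_imp_right]
  intro h1
  have h2 := (mul_eq_right₀ (pow_ne_zero 2 (norm_ne_zero_iff.2 h1))).1 hθ
  exact (pow_eq_one_iff_of_nonneg (norm_nonneg _) two_ne_zero).1 h2

theorem ae_of_bdryNormSq_comp_eq {a : ℕ → ℂ} {A : ℝ} (ha : ∀ k, ‖a k‖ ≤ A)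
    (hb : BoundedOnDisk (powerSum a))
    (heq : bdryNormSq (powerSum a ∘ h) = bdryNormSq (powerSum a)) (N : ℕ) :
    ∀ᵐ θ ∂arc, ‖bdryMap h θ‖ = 1 ∨ bdryMap (powerSum (fun k => a (k + N + 1)) ∘ h) θ = 0 := by
  rw [bdryNormSq_powerSum_eq_tsum ha hb] at heq
  have key (N : ℕ) : bdryNormSq (powerSum (fun k => a (k + N)) ∘ h) =
      2 * Real.pi * ∑' k, ‖a (k + N)‖ ^ 2 := by
    induction N with
    | zero => exact heq
    | succ N ih =>
      have := (ae_of_bdryNormSq_comp_eq_tsum hh hhU hh0 (fun k => ha (k + N))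
        (boundedOnDisk_powerSum_add ha hb N) ih).2
      simpa only [add_right_comm _ 1 N, ← add_assoc] using this
  have := (ae_of_bdryNormSq_comp_eq_tsum hh hhU hh0 (fun k => ha (k + N))
    (boundedOnDisk_powerSum_add ha hb N) (key N)).1
  simpa only [add_right_comm _ 1 N] using this

/-- Equality in Littlewood's subordination inequality forces the inner factor to be an inner
function. -/
theorem inner_of_bdryNormSq_comp_eq {F : ℂ → ℂ} (hF : HoloDisk F) (hb : BoundedOnDisk F)
    (hnc : ¬ ∃ c, ∀ z ∈ unitDisk, F z = c) (heq : bdryNormSq (F ∘ h) = bdryNormSq F) :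
    ∀ᵐ θ ∂arc, ‖bdryMap h θ‖ = 1 := by
  obtain ⟨a, A, ha, hFa⟩ := exists_powerSum_eqOn hF hb
  have hba := hb.congr hFa
  rw [bdryNormSq_congr hFa, bdryNormSq_congr (f := F ∘ h) (g := powerSum a ∘ h) fun z hz => hFa (hhU z hz)]
    at heq
  have hhb : ∀ z ∈ unitDisk, ‖h z‖ ≤ 1 := fun z hz => (norm_lt_one_of_mem (hhU z hz)).le
  filter_upwards [ae_hasBdry hh ⟨1, hhb⟩,
    ae_all_iff.2 (ae_of_bdryNormSq_comp_eq hh hhU hh0 ha hba heq)] with θ hθ hall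
  by_contra hne
  have hw : bdryMap h θ ∈ unitDisk := mem_ball_zero_iff.2 ((hθ.norm_le hhb).lt_of_ne hne)
  have hzero (N : ℕ) : powerSum (fun k => a (k + N + 1)) (bdryMap h θ) = 0 := by
    have hc : ContinuousAt (powerSum fun k => a (k + N + 1)) (bdryMap h θ) :=
      (holoDisk_powerSum fun k => ha (k + N + 1)).continuousOn.continuousAt
        (isOpen_ball.mem_nhds hw)
    rw [← (hall N).resolve_left hne]
    exact (hθ.bdryMap_comp_left hc).symm
  have hcoef (N : ℕ) : a (N + 1) = 0 := by
    have := powerSum_eq (fun k => ha (k + N + 1)) hw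
    simp only [zero_add] at this
    have h2 := hzero (N + 1)
    simp only [← add_assoc] at h2
    simp only [add_right_comm _ 1 N] at this
    rw [hzero N, h2, mul_zero, add_zero] at this
    exact this.symm
  refine hnc ⟨a 0, fun z hz => ?_⟩
  rw [hFa hz, powerSum_eq ha hz, powerSum]
  simp [hcoef]

end Rigidity

section Euclidean

variable {n : ℕ} {f : ℂ → En n} (hf : HoloDisk f) (hfb : BoundedOnDisk f)

include hf

theorem HoloDisk.coord (i : Fin n) : HoloDisk fun z => f z i :=
  (EuclideanSpace.proj i : En n →L[ℂ] ℂ).differentiable.comp_differentiableOn hf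

theorem HoloDisk.exp_clm (ℓ : En n →L[ℂ] ℂ) (t : ℝ) : HoloDisk fun z => exp (t * ℓ (f z)) :=
  ((ℓ.differentiable.comp_differentiableOn hf).const_mul (t : ℂ)).cexp

omit hf in
include hfb in
theorem BoundedOnDisk.coord (i : Fin n) : BoundedOnDisk fun z => f z i :=
  hfb.imp fun _ hM z hz => (PiLp.norm_apply_le (f z) i).trans (hM z hz)

omit hf in
include hfb in
theorem BoundedOnDisk.exp_clm (ℓ : En n →L[ℂ] ℂ) (t : ℝ) :
    BoundedOnDisk fun z => exp (t * ℓ (f z)) := by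
  obtain ⟨M, hM⟩ := hfb
  refine ⟨Real.exp (|t| * (‖ℓ‖ * M)), fun z hz => (norm_exp_le_exp_norm _).trans ?_⟩
  rw [norm_mul, norm_real, Real.norm_eq_abs]
  gcongr
  exact ℓ.le_of_opNorm_le_of_le le_rfl (hM z hz)

include hfb

theorem ae_hasBdry_euclidean : ∀ᵐ θ ∂arc, HasBdry f θ := by
  filter_upwards [ae_all_iff.2 fun i => ae_hasBdry (hf.coord i) (hfb.coord i)] with θ hθ
  have hpi : Tendsto (fun (r : ℝ) i => f (r * exp (θ * I)) i) (𝓝[<] 1)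
      (𝓝 fun i => bdryMap (fun z => f z i) θ) := tendsto_pi_nhds.2 hθ
  exact hasBdry_of_tendsto (((PiLp.continuous_toLp 2 fun _ : Fin n => ℂ).tendsto _).comp hpi)

theorem aemeasurable_bdryMap_euclidean : AEMeasurable (bdryMap f) arc :=
  (aestronglyMeasurable_bdryMap hf (ae_hasBdry_euclidean hf hfb)).aemeasurable

theorem holoMeasSet_eq_map {A : Set (En n)} (hA : MeasurableSet A) :
    holoMeasSet f A = (2 * Real.pi)⁻¹ * ((arc.map (bdryMap f)) A).toReal := by
  rw [Measure.map_apply_of_aemeasurable (aemeasurable_bdryMap_euclidean hf hfb) hA, arc,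
    Measure.restrict_apply' measurableSet_Ioc, holoMeasSet, hm0]
  congr 3
  ext θ
  simp [unitCircleS, bdryMap, norm_exp_ofReal_mul_I, and_comm]

theorem integral_normSq_coord_map (i : Fin n) :
    ∫ z, ‖z i‖ ^ 2 ∂(arc.map (bdryMap f)) = bdryNormSq fun z => f z i := by
  have hc : Continuous fun z : En n => ‖z i‖ ^ 2 := by fun_prop
  rw [integral_map (aemeasurable_bdryMap_euclidean hf hfb) hc.aestronglyMeasurable]
  refine integral_congr_ae ?_
  filter_upwards [ae_hasBdry_euclidean hf hfb] with θ hθ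
  have hci : Continuous fun z : En n => z i := by fun_prop
  rw [hθ.bdryMap_comp_left hci.continuousAt]

theorem mgf_map_bdryMap (L : StrongDual ℝ (En n)) (t : ℝ) :
    ProbabilityTheory.mgf L (arc.map (bdryMap f)) t =
      bdryNormSq fun z => exp ((t / 2 : ℝ) * L.extendRCLike (𝕜 := ℂ) (f z)) := by
  have hc : Continuous fun z : En n => Real.exp (t * L z) := by fun_prop
  rw [ProbabilityTheory.mgf,
    integral_map (aemeasurable_bdryMap_euclidean hf hfb) hc.aestronglyMeasurable]
  refine integral_congr_ae ?_
  filter_upwards [ae_hasBdry_euclidean hf hfb] with θ hθ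
  have hce : Continuous fun z : En n => exp ((t / 2 : ℝ) * L.extendRCLike (𝕜 := ℂ) z) := by fun_prop
  have hre : (L.extendRCLike (𝕜 := ℂ) (bdryMap f θ)).re = L (bdryMap f θ) :=
    StrongDual.re_extendRCLike_apply (𝕜 := ℂ) L (bdryMap f θ)
  rw [hθ.bdryMap_comp_left hce.continuousAt, norm_exp, re_ofReal_mul, hre, ← Real.exp_nat_mul]
  congr 1
  push_cast
  ring

theorem integrable_exp_map_bdryMap (L : StrongDual ℝ (En n)) (t : ℝ) :
    Integrable (fun z => Real.exp (t * L z)) (arc.map (bdryMap f)) := by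
  have hc : Continuous fun z : En n => Real.exp (t * L z) := by fun_prop
  have hm := aemeasurable_bdryMap_euclidean hf hfb
  rw [integrable_map_measure hc.aestronglyMeasurable hm]
  have hae := ae_hasBdry_euclidean hf hfb
  obtain ⟨M, hM⟩ := hfb
  refine Integrable.of_bound (hc.measurable.comp_aemeasurable hm).aestronglyMeasurable
    (Real.exp (|t| * (‖L‖ * M))) ?_
  filter_upwards [hae] with θ hθ
  rw [Function.comp_apply, Real.norm_eq_abs, Real.abs_exp]
  refine Real.exp_le_exp.2 ((le_abs_self _).trans ?_)
  rw [abs_mul]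
  gcongr
  exact L.le_of_opNorm_le_of_le le_rfl (hθ.norm_le hM)

/-- Composition with an inner function fixing the origin preserves the distribution of the
boundary values. -/
theorem map_bdryMap_comp_inner {h : ℂ → ℂ} (hh : HoloDisk h)
    (hhU : ∀ ζ ∈ unitDisk, h ζ ∈ unitDisk) (hh0 : h 0 = 0)
    (hin : ∀ᵐ θ ∂arc, ‖bdryMap h θ‖ = 1) :
    arc.map (bdryMap f) = arc.map (bdryMap (f ∘ h)) := by
  have hfh := hf.comp_self hh hhU
  have hfhb := hfb.comp_self hhU
  refine Measure.ext_of_charFunDual (funext fun L => ?_)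
  have hmgf : ProbabilityTheory.mgf L (arc.map (bdryMap f)) =
      ProbabilityTheory.mgf L (arc.map (bdryMap (f ∘ h))) := by
    ext t
    rw [mgf_map_bdryMap hf hfb, mgf_map_bdryMap hfh hfhb]
    exact (bdryNormSq_comp_inner hh hhU hh0 hin (hf.exp_clm (L.extendRCLike (𝕜 := ℂ)) (t / 2))
      (hfb.exp_clm _ _)).symm
  have hzero : arc.map (bdryMap f) = 0 ↔ arc.map (bdryMap (f ∘ h)) = 0 := by
    rw [Measure.map_eq_zero_iff (aemeasurable_bdryMap_euclidean hf hfb),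
      Measure.map_eq_zero_iff (aemeasurable_bdryMap_euclidean hfh hfhb)]
  have huniv : ProbabilityTheory.integrableExpSet L (arc.map (bdryMap f)) = Set.univ :=
    Set.eq_univ_of_forall (integrable_exp_map_bdryMap hf hfb L)
  have := ProbabilityTheory.eqOn_complexMGF_of_mgf' hmgf hzero (x := I) (by simp [huniv])
  simpa only [ProbabilityTheory.complexMGF, charFunDual_apply, mul_comm I] using this

end Euclidean

/-- Theorem 1.1: for a bounded nonconstant holomorphic map `f : U → ℂⁿ`
and a holomorphic `h : U → U` with `h 0 = 0`, the holomorphic measures of `f` and `f ∘ h`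
agree (on all Borel sets) iff `h` is inner. -/
theorem statement0 {n : ℕ} (f : ℂ → En n) (hf : HoloDisk f) (hfb : BoundedOnDisk f)
    (hfnc : ¬ ∃ c : En n, ∀ ζ ∈ unitDisk, f ζ = c)
    (h : ℂ → ℂ) (hh : HoloDisk h) (hhU : ∀ ζ ∈ unitDisk, h ζ ∈ unitDisk) (hh0 : h 0 = 0) :
    (∀ A : Set (En n), MeasurableSet A → holoMeasSet f A = holoMeasSet (f ∘ h) A) ↔
      (∀ᵐ θ : ℝ ∂(volume.restrict (Set.Ioc (0:ℝ) (2 * Real.pi))),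
        ‖bdryMap h θ‖ = 1) := by
  have hfh := hf.comp_self hh hhU
  have hfhb := hfb.comp_self hhU
  constructor
  · intro heq
    have hmap : arc.map (bdryMap f) = arc.map (bdryMap (f ∘ h)) := by
      ext A hA
      have hA' := heq A hA
      rw [holoMeasSet_eq_map hf hfb hA, holoMeasSet_eq_map hfh hfhb hA,
        mul_right_inj' (inv_ne_zero Real.two_pi_pos.ne')] at hA'
      exact (ENNReal.toReal_eq_toReal_iff' (measure_ne_top _ _) (measure_ne_top _ _)).1 hA'
    obtain ⟨i, hi⟩ : ∃ i, ¬ ∃ c, ∀ z ∈ unitDisk, f z i = c := by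
      by_contra! hall
      choose c hc using hall
      exact hfnc ⟨WithLp.toLp 2 c, fun z hz => PiLp.ext fun i => hc i z hz⟩
    refine inner_of_bdryNormSq_comp_eq hh hhU hh0 (hf.coord i) (hfb.coord i) hi ?_
    rw [← integral_normSq_coord_map hf hfb, hmap, integral_normSq_coord_map hfh hfhb]
    rfl
  · intro hin A hA
    rw [holoMeasSet_eq_map hf hfb hA, holoMeasSet_eq_map hfh hfhb hA,
      map_bdryMap_comp_inner hf hfb hh hhU hh0 hin]

end
end

section
/- Let L = {f_j} be a uniformly bounded sequence of holomorphic mappings of the unit disk into ℂⁿ and let h ∈ 𝓗(L). If |h| < M on cl L and |h| < m < M on a set E ⊆ cl L, then for every z ∈ cl L one has |h(z)| ≤ m^d M^{1−d}, where d = ω(z, E, L). -/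
open MeasureTheory Complex Filter Metric Set Topology

noncomputable section

theorem norm_le_of_norm_le_mul_exp_on_sphere {E : Type*} [NormedAddCommGroup E] [NormedSpace ℂ E]
    {H : ℂ → E} (hH : DiffContOnCl ℂ H (ball 0 1)) {w : ℂ} (hw : ‖w‖ = 1) {ε l : ℝ} (hε : 0 ≤ ε)
    (hb : ∀ ζ ∈ sphere (0 : ℂ) 1, ‖H ζ‖ ≤ ε * ‖ζ - w‖ * Real.exp (l * ‖ζ - w‖ ^ 2 / 2))
    {z : ℂ} (hz : z ∈ ball (0 : ℂ) 1) :
    ‖H z‖ ≤ ε * ‖z - w‖ * Real.exp (l * (1 - z * (starRingEnd ℂ) w).re) := by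
  set q : ℂ → ℂ := fun z => 1 - z * (starRingEnd ℂ) w with hq
  have hww : w * (starRingEnd ℂ) w = 1 := by
    rw [Complex.mul_conj, Complex.normSq_eq_norm_sq, hw]; simp
  have hqn : ∀ z, ‖q z‖ = ‖z - w‖ := by
    intro z
    have : q z = (w - z) * (starRingEnd ℂ) w := by simp only [hq]; rw [sub_mul, hww]
    rw [this, norm_mul, Complex.norm_conj, hw, mul_one, norm_sub_rev]
  have hqre : ∀ z, ‖z‖ ≤ 1 → 0 ≤ (q z).re := by
    intro z hz
    have h1 : (z * (starRingEnd ℂ) w).re ≤ 1 := by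
      refine (Complex.re_le_norm _).trans ?_
      rw [norm_mul, Complex.norm_conj, hw, mul_one]; exact hz
    simp only [hq, Complex.sub_re, Complex.one_re]; linarith
  have hqs : ∀ z, ‖z‖ = 1 → (q z).re = ‖z - w‖ ^ 2 / 2 := by
    intro z hz
    rw [← hqn]
    have h2 : ‖z * (starRingEnd ℂ) w‖ = 1 := by rw [norm_mul, Complex.norm_conj, hw, hz, mul_one]
    have h3 : ‖z * (starRingEnd ℂ) w‖ ^ 2 = 1 := by rw [h2]; norm_num
    simp only [hq]
    generalize z * (starRingEnd ℂ) w = a at h3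
    rw [← Complex.normSq_eq_norm_sq, Complex.normSq_apply] at h3 ⊢
    simp
    nlinarith
  have key : ∀ τ : ℝ, 0 < τ → ‖H z‖ ≤ ε * ‖q z + τ‖ * Real.exp (l * (q z).re) := by
    intro τ hτ
    have hpos : ∀ z, ‖z‖ ≤ 1 → q z + τ ≠ 0 := by
      intro z hz h0
      have := congrArg Complex.re h0
      simp only [Complex.add_re, Complex.ofReal_re, Complex.zero_re] at this
      linarith [hqre z hz]
    have hqd : Differentiable ℂ q := by simp only [hq]; fun_prop
    have hd : DiffContOnCl ℂ (fun z => (Complex.exp (-(l : ℂ) * q z) / (q z + τ))) (ball 0 1) := by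
      apply DifferentiableOn.diffContOnCl
      rw [closure_ball _ one_ne_zero]
      intro x hx
      have := hpos x (by simpa using hx)
      apply DifferentiableAt.differentiableWithinAt
      exact DifferentiableAt.fun_div (by fun_prop) (by fun_prop) this
    have hT := hd.smul hH
    have hexp : ∀ z, ‖Complex.exp (-(l : ℂ) * q z)‖ = Real.exp (-(l * (q z).re)) := by
      intro z; rw [Complex.norm_exp]; simp
    have := Complex.norm_le_of_forall_mem_frontier_norm_le (C := ε) isBounded_ball hT (by
      intro ζ hζ
      rw [frontier_ball _ one_ne_zero] at hζ
      have hζ1 : ‖ζ‖ = 1 := by simpa using hζ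
      have hn : 0 < ‖q ζ + τ‖ := norm_pos_iff.mpr (hpos ζ hζ1.le)
      have hle : ‖q ζ‖ ≤ ‖q ζ + τ‖ := by
        have h0 := hqre ζ hζ1.le
        rw [← sq_le_sq₀ (norm_nonneg _) (norm_nonneg _), ← Complex.normSq_eq_norm_sq,
          ← Complex.normSq_eq_norm_sq, Complex.normSq_apply, Complex.normSq_apply]
        simp
        nlinarith
      rw [norm_smul, norm_div, hexp, hqs ζ hζ1]
      calc _ ≤ Real.exp (-(l * (‖ζ - w‖ ^ 2 / 2))) / ‖q ζ + τ‖ *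
            (ε * ‖ζ - w‖ * Real.exp (l * ‖ζ - w‖ ^ 2 / 2)) := by gcongr; exact hb ζ hζ
        _ = ε * (‖ζ - w‖ / ‖q ζ + τ‖) := by
          rw [Real.exp_neg, ← mul_div_assoc]; field_simp
        _ ≤ ε * 1 := by
          gcongr; rw [div_le_one hn, ← hqn]; exact hle
        _ = ε := mul_one _) (subset_closure hz)
    have hz1 : ‖z‖ ≤ 1 := by simpa using (mem_ball_zero_iff.1 hz).le
    have hn : 0 < ‖q z + τ‖ := norm_pos_iff.mpr (hpos z hz1)
    rw [norm_smul, norm_div, hexp, Real.exp_neg] at this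
    have he := Real.exp_pos (l * (q z).re)
    rw [inv_div_left, inv_mul_le_iff₀ (by positivity)] at this
    linarith
  have hlim : Tendsto (fun τ : ℝ => ε * ‖q z + τ‖ * Real.exp (l * (q z).re)) (𝓝[>] 0)
      (𝓝 (ε * ‖q z + (0 : ℝ)‖ * Real.exp (l * (q z).re))) := by
    apply Tendsto.mono_left _ nhdsWithin_le_nhds
    apply Continuous.tendsto
    fun_prop
  have := ge_of_tendsto hlim (eventually_nhdsWithin_of_forall fun τ hτ => key τ hτ)
  rwa [Complex.ofReal_zero, add_zero, hqn] at this

theorem tendsto_deriv_radial_zero {E : Type*} [NormedAddCommGroup E] [NormedSpace ℂ E]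
    {H : ℂ → E} (hH : DiffContOnCl ℂ H (ball 0 1)) {w : ℂ} (hw : ‖w‖ = 1) {C : ℝ}
    (hC : ∀ ζ ∈ sphere (0 : ℂ) 1, ‖H ζ‖ ≤ C)
    (ho : ∀ ε > 0, ∀ᶠ ζ in 𝓝[sphere 0 1] w, ‖H ζ‖ ≤ ε * ‖ζ - w‖) :
    Tendsto (fun r : ℝ => deriv H (r * w)) (𝓝[<] 1) (𝓝 0) := by
  rw [Metric.tendsto_nhds]
  intro δ hδ
  set ε : ℝ := δ / 12 with hεd
  have hε : 0 < ε := by positivity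
  obtain ⟨η, hη, hη'⟩ := Metric.mem_nhdsWithin_iff.1 (ho ε hε)
  obtain ⟨l, hl, hlC⟩ : ∃ l : ℝ, 0 ≤ l ∧ C ≤ ε * η * Real.exp (l * η ^ 2 / 2) := by
    have : Tendsto (fun l : ℝ => ε * η * Real.exp (l * η ^ 2 / 2)) atTop atTop := by
      apply Tendsto.const_mul_atTop (by positivity)
      apply Real.tendsto_exp_atTop.comp
      apply Tendsto.atTop_div_const (by positivity)
      exact tendsto_id.atTop_mul_const (by positivity)
    obtain ⟨l, h1, h2⟩ := ((eventually_ge_atTop 0).and (this.eventually_ge_atTop C)).exists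
    exact ⟨l, h1, h2⟩
  have hmain : ∀ z ∈ ball (0 : ℂ) 1,
      ‖H z‖ ≤ ε * ‖z - w‖ * Real.exp (l * (1 - z * (starRingEnd ℂ) w).re) := by
    intro z hz
    apply norm_le_of_norm_le_mul_exp_on_sphere hH hw hε.le _ hz
    intro ζ hζ
    by_cases hζw : ‖ζ - w‖ < η
    · have h1 : ‖H ζ‖ ≤ ε * ‖ζ - w‖ := hη' ⟨by simpa [dist_eq_norm] using hζw, hζ⟩
      refine h1.trans (le_mul_of_one_le_right (by positivity) ?_)
      apply Real.one_le_exp; positivity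
    · push Not at hζw
      refine ((hC ζ hζ).trans hlC).trans ?_
      gcongr
  have hcont : Tendsto (fun r : ℝ => Real.exp (l * (3 * ((1 - r) / 2)))) (𝓝[<] 1) (𝓝 1) := by
    apply Tendsto.mono_left _ nhdsWithin_le_nhds
    have : Continuous (fun r : ℝ => Real.exp (l * (3 * ((1 - r) / 2)))) := by fun_prop
    simpa using this.tendsto 1
  have h0 : ∀ᶠ r : ℝ in 𝓝[<] 1, 0 < r :=
    nhdsWithin_le_nhds (lt_mem_nhds one_pos)
  filter_upwards [hcont.eventually_lt_const (show (1 : ℝ) < 2 by norm_num), h0,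
    self_mem_nhdsWithin] with r hr hr0 hr1
  have hr1 : r < 1 := hr1
  set ρ := (1 - r) / 2 with hρ
  have hρ0 : 0 < ρ := by simp only [hρ]; linarith
  have hrw : ‖(r : ℂ) * w‖ = r := by
    rw [norm_mul, hw, mul_one, Complex.norm_real, Real.norm_of_nonneg hr0.le]
  have hsub : closedBall ((r : ℂ) * w) ρ ⊆ ball 0 1 := by
    intro z hz
    rw [mem_closedBall, dist_eq_norm] at hz
    rw [mem_ball_zero_iff]
    calc ‖z‖ = ‖(z - r * w) + r * w‖ := by rw [sub_add_cancel]
      _ ≤ ρ + r := (norm_add_le _ _).trans (by rw [hrw]; linarith)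
      _ < 1 := by simp only [hρ]; linarith
  have hrww : ‖(r : ℂ) * w - w‖ = 2 * ρ := by
    have : (r : ℂ) * w - w = ((r - 1 : ℝ) : ℂ) * w := by push_cast; ring
    rw [this, norm_mul, hw, mul_one, Complex.norm_real, Real.norm_of_nonpos (by linarith)]
    simp only [hρ]; ring
  have hd := Complex.norm_deriv_le_of_forall_mem_sphere_norm_le (C := ε * (3 * ρ) * 2) hρ0
    (hH.mono (ball_subset_closedBall.trans hsub)) (by
      intro z hz
      have hzb := hsub (sphere_subset_closedBall hz)
      have hzw : ‖z - w‖ ≤ 3 * ρ := by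
        calc ‖z - w‖ = ‖(z - r * w) + (r * w - w)‖ := by congr 1; ring
          _ ≤ ρ + 2 * ρ := (norm_add_le _ _).trans
            (by rw [hrww, ← dist_eq_norm, mem_sphere.1 hz])
          _ = 3 * ρ := by ring
      have hre : (1 - z * (starRingEnd ℂ) w).re ≤ 3 * ρ := by
        refine (Complex.re_le_norm _).trans (le_trans (le_of_eq ?_) hzw)
        have hww : w * (starRingEnd ℂ) w = 1 := by
          rw [Complex.mul_conj, Complex.normSq_eq_norm_sq, hw]; simp
        rw [← hww, ← sub_mul, norm_mul, Complex.norm_conj, hw, mul_one, norm_sub_rev]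
      refine (hmain z hzb).trans ?_
      have : Real.exp (l * (1 - z * (starRingEnd ℂ) w).re) ≤ 2 :=
        (Real.exp_le_exp.2 (by gcongr)).trans hr.le
      gcongr)
  rw [dist_zero_right]
  refine hd.trans_lt ?_
  have : ε * (3 * ρ) * 2 / ρ = δ / 2 := by rw [hεd]; field_simp; norm_num
  rw [this]; linarith

theorem lipschitzWith_exp_ofReal_mul_I :
    LipschitzWith 1 (fun θ : ℝ => Complex.exp (θ * Complex.I)) := by
  apply lipschitzWith_of_nnnorm_deriv_le
  · fun_prop
  · intro x
    have : HasDerivAt (fun θ : ℝ => Complex.exp (θ * Complex.I))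
        (Complex.exp (x * Complex.I) * (1 * Complex.I)) x :=
      (((Complex.ofRealCLM.hasDerivAt (x := x)).mul_const Complex.I)).cexp
    rw [this.deriv, ← NNReal.coe_le_coe, coe_nnnorm, norm_mul, Complex.norm_exp_ofReal_mul_I]
    simp

/-- The **Fatou theorem** for bounded vector-valued holomorphic functions on the disk. -/
theorem ae_exists_radial_limit_s9 {E : Type*} [NormedAddCommGroup E] [NormedSpace ℂ E]
    [FiniteDimensional ℂ E] {F : ℂ → E} (hF : DifferentiableOn ℂ F (ball 0 1)) {R : ℝ}
    (hR : ∀ z ∈ ball (0 : ℂ) 1, ‖F z‖ ≤ R) :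
    ∀ᵐ θ : ℝ, ∃ a : E, Tendsto (fun r : ℝ => F (r * Complex.exp (θ * Complex.I)))
      (𝓝[<] 1) (𝓝 a) := by
  have : CompleteSpace E := FiniteDimensional.complete ℂ E
  let : NormedSpace ℝ E := NormedSpace.restrictScalars ℝ ℂ E
  have : FiniteDimensional ℝ E := FiniteDimensional.complexToReal E
  obtain ⟨G₀, hG₀⟩ := hF.isExactOn_ball
  have hlip : LipschitzOnWith R.toNNReal G₀ (ball 0 1) := by
    apply (convex_ball (0 : ℂ) 1).lipschitzOnWith_of_nnnorm_hasDerivWithin_le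
      (fun x hx => (hG₀ x hx).hasDerivWithinAt)
    intro x hx
    rw [← NNReal.coe_le_coe, coe_nnnorm]
    exact (hR x hx).trans (Real.le_coe_toNNReal R)
  obtain ⟨G, hG, hGeq⟩ := hlip.extend_finite_dimension
  have hGd : ∀ z ∈ ball (0 : ℂ) 1, HasDerivAt G (F z) z := fun z hz =>
    (hG₀ z hz).congr_of_eventuallyEq
      (Filter.eventuallyEq_of_mem (isOpen_ball.mem_nhds hz) fun y hy => (hGeq hy).symm)
  filter_upwards [(hG.comp lipschitzWith_exp_ofReal_mul_I).ae_differentiableAt_real] with θ hθ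
  set w := Complex.exp (θ * Complex.I) with hwdef
  have hw : ‖w‖ = 1 := Complex.norm_exp_ofReal_mul_I θ
  have hw0 : w ≠ 0 := Complex.exp_ne_zero _
  set g' := deriv (G ∘ fun θ : ℝ => Complex.exp (θ * Complex.I)) θ with hg'
  set c : E := (w * Complex.I)⁻¹ • g' with hc
  refine ⟨c, ?_⟩
  set H : ℂ → E := fun z => G z - G w - (z - w) • c with hHdef
  have hHcont : Continuous H := by
    have := hG.continuous
    simp only [hHdef]; fun_prop
  have hHd : ∀ z ∈ ball (0 : ℂ) 1, HasDerivAt H (F z - c) z := by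
    intro z hz
    have := ((hGd z hz).sub_const (G w)).sub (((hasDerivAt_id z).sub_const w).smul_const c)
    rw [one_smul] at this
    exact this
  have hHH : DiffContOnCl ℂ H (ball 0 1) :=
    ⟨fun z hz => (hHd z hz).differentiableAt.differentiableWithinAt, hHcont.continuousOn⟩
  obtain ⟨C, hC⟩ := (isCompact_sphere (0 : ℂ) 1).exists_bound_of_continuousOn hHcont.continuousOn
  have hderiv : HasDerivAt (fun t : ℝ => H (Complex.exp (t * Complex.I))) 0 θ := by
    have h1 : HasDerivAt (fun θ : ℝ => Complex.exp (θ * Complex.I))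
          (w * Complex.I) θ := by
      simpa using (((Complex.ofRealCLM.hasDerivAt (x := θ)).mul_const Complex.I)).cexp
    have h2 := ((hθ.hasDerivAt).sub_const (G w)).sub ((h1.sub_const w).smul_const c)
    have h3 : deriv (G ∘ fun θ : ℝ => Complex.exp (θ * Complex.I)) θ - (w * Complex.I) • c = 0 := by
      rw [hc, smul_smul, mul_inv_cancel₀ (mul_ne_zero hw0 Complex.I_ne_zero), one_smul, sub_self]
    rw [h3] at h2
    exact h2
  have ho : ∀ ε > 0, ∀ᶠ ζ in 𝓝[sphere 0 1] w, ‖H ζ‖ ≤ ε * ‖ζ - w‖ := by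
    intro ε hε
    have hHw : H (Complex.exp (θ * Complex.I)) = 0 := by simp [hHdef, ← hwdef]
    have h1 := (hasDerivAt_iff_isLittleO.1 hderiv).def (show 0 < ε / 2 by positivity)
    have harg : Tendsto (fun ζ : ℂ => θ + Complex.arg (ζ / w)) (𝓝[sphere 0 1] w) (𝓝 θ) := by
      apply Tendsto.mono_left _ nhdsWithin_le_nhds
      have : ContinuousAt (fun ζ : ℂ => θ + Complex.arg (ζ / w)) w := by
        apply continuousAt_const.add
        apply ContinuousAt.comp (g := Complex.arg)
        · rw [div_self hw0]; exact Complex.continuousAt_arg Complex.one_mem_slitPlane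
        · fun_prop
      simpa [ContinuousAt, div_self hw0] using this
    filter_upwards [harg.eventually h1, self_mem_nhdsWithin] with ζ hζ hζ1
    have hζn : ‖ζ / w‖ = 1 := by rw [norm_div, hw, div_one]; simpa using hζ1
    have hζe : Complex.exp (((θ + Complex.arg (ζ / w) : ℝ) : ℂ) * Complex.I) = ζ := by
      have := Complex.norm_mul_exp_arg_mul_I (ζ / w)
      rw [hζn, Complex.ofReal_one, one_mul] at this
      push_cast
      rw [add_mul, Complex.exp_add, this, ← hwdef, mul_div_cancel₀ _ hw0]
    simp only [hζe, hHw, sub_zero, smul_zero, add_sub_cancel_left] at hζ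
    have harg2 : ‖Complex.arg (ζ / w)‖ ≤ 2 * ‖ζ - w‖ := by
      have hne : ζ / w ≠ 0 := norm_ne_zero_iff.1 (by rw [hζn]; exact one_ne_zero)
      have h4 := (Complex.norm_sub_mem_Icc_angle hζn (norm_one (α := ℂ))).1
      rw [Complex.angle_one_right hne, div_sub_one hw0, norm_div, hw, div_one, div_mul_eq_mul_div,
        div_le_iff₀ Real.pi_pos] at h4
      rw [Real.norm_eq_abs]
      nlinarith [Real.pi_le_four, norm_nonneg (ζ - w)]
    refine hζ.trans ?_
    calc _ ≤ ε / 2 * (2 * ‖ζ - w‖) := by gcongr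
      _ = _ := by ring
  have := tendsto_deriv_radial_zero hHH hw hC ho
  have h3 : Tendsto (fun r : ℝ => F (r * w) - c) (𝓝[<] 1) (𝓝 0) := by
    refine this.congr' ?_
    have h0 : ∀ᶠ r : ℝ in 𝓝[<] 1, 0 < r := nhdsWithin_le_nhds (lt_mem_nhds one_pos)
    filter_upwards [h0, self_mem_nhdsWithin] with r hr0 hr1
    apply (hHd _ _).deriv
    rw [mem_ball_zero_iff, norm_mul, hw, mul_one, Complex.norm_real, Real.norm_of_nonneg hr0.le]
    exact hr1
  simpa using h3.add_const c

/-- Boundary points of a Lebesgue-null set of angles are negligible for positive harmonic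
functions, in the sense of radial limits. -/
theorem exists_small_re_barrier {N : Set ℝ} (hN : volume N = 0) {ε : ℝ} (hε : 0 < ε) :
    ∃ Φ : ℂ → ℂ, DifferentiableOn ℂ Φ (ball 0 1) ∧ (∀ z ∈ ball (0 : ℂ) 1, 0 ≤ (Φ z).re) ∧
      (∀ z ∈ ball (0 : ℂ) 1, (Φ z).re ≤ ε / (1 - ‖z‖)) ∧
      ∀ θ ∈ N, ∀ᶠ r : ℝ in 𝓝[<] 1, 1 ≤ (Φ (r * Complex.exp (θ * Complex.I))).re := by
  obtain ⟨t, δ, htc, -, hδ', hcov, hsum⟩ :=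
    Besicovitch.exists_closedBall_covering_tsum_measure_le (volume : Measure ℝ)
      (ε := ENNReal.ofReal (ε / 9)) (by simpa using hε) (fun _ => Ioi 0) N
      (fun x _ δ hδ => ⟨δ / 2, mem_Ioi.2 (by positivity), by positivity, by linarith⟩)
  have hδ : ∀ x : t, 0 < δ x := fun x => hδ' x x.2
  simp only [Real.volume_closedBall, hN, zero_add] at hsum
  have hne := ne_top_of_le_ne_top ENNReal.ofReal_ne_top hsum
  have htr : ∀ x : t, (ENNReal.ofReal (2 * δ x)).toReal = 2 * δ x := fun x =>
    ENNReal.toReal_ofReal (by have := hδ x; positivity)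
  have hs2 : Summable fun x : t => 2 * δ x := by
    simpa only [htr] using ENNReal.summable_toReal hne
  have hs : Summable fun x : t => δ x := by simpa using hs2.mul_left (2⁻¹ : ℝ)
  have hsum' : ∑' x : t, δ x ≤ ε / 9 := by
    have h1 : ∑' x : t, 2 * δ x ≤ ε / 9 := by
      have := ENNReal.toReal_mono ENNReal.ofReal_ne_top hsum
      rw [ENNReal.tsum_toReal_eq (fun _ => ENNReal.ofReal_ne_top),
        ENNReal.toReal_ofReal (by positivity)] at this
      simpa only [htr] using this
    refine (hs.tsum_le_tsum (fun x => ?_) hs2).trans h1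
    linarith [hδ x]
  set e : ℝ → ℂ := fun x => Complex.exp (x * Complex.I) with he
  have hen : ∀ x, ‖e x‖ = 1 := Complex.norm_exp_ofReal_mul_I
  set q : t → ℂ → ℂ := fun x z => (1 + δ x : ℝ) - z * (starRingEnd ℂ) (e x) with hq
  have hqre : ∀ (x : t) (z : ℂ), 1 + δ x - ‖z‖ ≤ (q x z).re := by
    intro x z
    have h1 : (z * (starRingEnd ℂ) (e x)).re ≤ ‖z‖ := by
      refine (Complex.re_le_norm _).trans ?_
      rw [norm_mul, Complex.norm_conj, hen, mul_one]
    simp only [hq, Complex.sub_re, Complex.ofReal_re]; linarith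
  have hqn : ∀ (x : t) (z : ℂ), 1 - ‖z‖ ≤ ‖q x z‖ := fun x z => by
    linarith [hqre x z, hδ x, Complex.re_le_norm (q x z)]
  set T : t → ℂ → ℂ := fun x z => (9 * δ x : ℝ) / q x z with hT
  have hTre : ∀ (x : t) (z : ℂ), (T x z).re = 9 * δ x * ((q x z).re / ‖q x z‖ ^ 2) := by
    intro x z
    simp only [hT]
    rw [div_eq_mul_inv, Complex.re_ofReal_mul, Complex.inv_re, Complex.normSq_eq_norm_sq]
  have hTn : ∀ (x : t) (z : ℂ), z ∈ ball (0 : ℂ) 1 → ‖T x z‖ ≤ δ x * (9 / (1 - ‖z‖)) := by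
    intro x z hz
    have hz' : 0 < 1 - ‖z‖ := by linarith [mem_ball_zero_iff.1 hz]
    have := hδ x
    simp only [hT]
    rw [norm_div, Complex.norm_real, Real.norm_of_nonneg (by positivity)]
    calc 9 * δ x / ‖q x z‖ ≤ 9 * δ x / (1 - ‖z‖) := by gcongr; exact hqn x z
      _ = _ := by ring
  have hT0 : ∀ (x : t) (z : ℂ), z ∈ ball (0 : ℂ) 1 → 0 ≤ (T x z).re := by
    intro x z hz
    have hz' : 0 < 1 - ‖z‖ := by linarith [mem_ball_zero_iff.1 hz]
    have := hδ x
    have := hqre x z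
    rw [hTre]
    have : 0 ≤ (q x z).re := by linarith
    positivity
  have hTs : ∀ z ∈ ball (0 : ℂ) 1, Summable fun x => T x z := fun z hz =>
    Summable.of_norm_bounded (hs.mul_right _) fun x => hTn x z hz
  have hre : ∀ z ∈ ball (0 : ℂ) 1, HasSum (fun x => (T x z).re) (∑' x, T x z).re :=
    fun z hz => Complex.hasSum_re (hTs z hz).hasSum
  refine ⟨fun z => ∑' x, T x z, ?_, ?_, ?_, ?_⟩
  · intro z hz
    obtain ⟨ρ, hzρ, hρ⟩ := exists_between (mem_ball_zero_iff.1 hz)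
    have hd : DifferentiableOn ℂ (fun z => ∑' x, T x z) (ball 0 ρ) := by
      apply differentiableOn_tsum_of_summable_norm (hs.mul_right (9 / (1 - ρ))) _ isOpen_ball
      · intro x y hy
        have hy1 := mem_ball_zero_iff.1 hy
        refine (hTn x y (ball_subset_ball hρ.le hy)).trans ?_
        have := hδ x
        have : 0 < 1 - ρ := by linarith
        gcongr
      · intro x y hy
        have hy1 := mem_ball_zero_iff.1 hy
        have hne : q x y ≠ 0 := by
          rw [← norm_pos_iff]; linarith [hqn x y]
        apply DifferentiableAt.differentiableWithinAt
        exact DifferentiableAt.fun_div (by fun_prop) (by simp only [hq]; fun_prop) hne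
    exact (hd.differentiableAt (isOpen_ball.mem_nhds
      (mem_ball_zero_iff.2 hzρ))).differentiableWithinAt
  · intro z hz
    exact (hre z hz).nonneg fun x => hT0 x z hz
  · intro z hz
    have hz' : 0 < 1 - ‖z‖ := by linarith [mem_ball_zero_iff.1 hz]
    calc (∑' x, T x z).re ≤ (∑' x : t, δ x) * (9 / (1 - ‖z‖)) := by
          refine hasSum_le (fun x => ?_) (hre z hz) (hs.hasSum.mul_right _)
          exact (Complex.re_le_norm _).trans (hTn x z hz)
      _ ≤ ε / 9 * (9 / (1 - ‖z‖)) := by gcongr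
      _ = ε / (1 - ‖z‖) := by field_simp
  · intro θ hθ
    obtain ⟨x, hxt, hx⟩ := mem_iUnion₂.1 (hcov hθ)
    have hδx := hδ' x hxt
    have h0 : ∀ᶠ r : ℝ in 𝓝[<] 1, max 0 (1 - δ x) < r :=
      nhdsWithin_le_nhds (lt_mem_nhds (max_lt one_pos (by linarith [mem_Ioi.1 hδx])))
    filter_upwards [h0, self_mem_nhdsWithin] with r hr hr1
    have hr1 : r < 1 := hr1
    have hδx : 0 < δ x := hδx
    have hr0 : 0 < r := (le_max_left _ _).trans_lt hr
    have hr2 : 1 - r < δ x := by linarith [(le_max_right 0 (1 - δ x)).trans_lt hr]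
    have hzn : ‖(r : ℂ) * e θ‖ = r := by
      rw [norm_mul, hen, mul_one, Complex.norm_real, Real.norm_of_nonneg hr0.le]
    have hz : (r : ℂ) * e θ ∈ ball (0 : ℂ) 1 := by rw [mem_ball_zero_iff, hzn]; exact hr1
    have h1 : 1 ≤ (T ⟨x, hxt⟩ (r * e θ)).re := by
      have hq1 := hqre ⟨x, hxt⟩ (r * e θ)
      have hq2 : ‖q ⟨x, hxt⟩ (r * e θ)‖ ≤ 3 * δ x := by
        have hex : e x * (starRingEnd ℂ) (e x) = 1 := by
          rw [Complex.mul_conj, Complex.normSq_eq_norm_sq, hen]; simp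
        have : q ⟨x, hxt⟩ (r * e θ) = (δ x : ℂ) + ((1 - r : ℝ) : ℂ)
            - r * ((e θ - e x) * (starRingEnd ℂ) (e x)) := by
          simp only [hq]; push_cast; rw [sub_mul, hex]; ring
        rw [this]
        have hexp : ‖e θ - e x‖ ≤ δ x := by
          have := lipschitzWith_exp_ofReal_mul_I.dist_le_mul θ x
          rw [dist_eq_norm, NNReal.coe_one, one_mul] at this
          exact this.trans (mem_closedBall.1 hx)
        calc _ ≤ ‖(δ x : ℂ)‖ + ‖((1 - r : ℝ) : ℂ)‖ +
              ‖(r : ℂ) * ((e θ - e x) * (starRingEnd ℂ) (e x))‖ :=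
              (norm_sub_le _ _).trans (by gcongr; exact norm_add_le _ _)
          _ ≤ δ x + δ x + 1 * δ x := by
            rw [norm_mul, norm_mul, Complex.norm_conj, hen, mul_one, Complex.norm_real,
              Complex.norm_real, Complex.norm_real, Real.norm_of_nonneg hδx.le,
              Real.norm_of_nonneg hr0.le, Real.norm_of_nonneg (by linarith)]
            gcongr
          _ = _ := by ring
      rw [hzn] at hq1
      have hq3 : δ x ≤ (q ⟨x, hxt⟩ (r * e θ)).re := by
        have : 1 + δ x - r ≤ (q ⟨x, hxt⟩ (r * e θ)).re := hq1
        linarith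
      have hq4 : 0 < ‖q ⟨x, hxt⟩ (r * e θ)‖ :=
        hδx.trans_le (hq3.trans (Complex.re_le_norm _))
      rw [hTre]
      calc (1 : ℝ) = 9 * δ x * (δ x / (3 * δ x) ^ 2) := by field_simp; norm_num
        _ ≤ _ := by gcongr; exact hδx.le.trans hq3
    refine h1.trans ?_
    exact le_hasSum (hre _ hz) ⟨x, hxt⟩ fun y _ => hT0 y _ hz

theorem posLog_norm_le_circleAverage {G : ℂ → ℂ} {c : ℂ} {ρ : ℝ} (hρ : 0 < ρ)
    (hG : AnalyticOnNhd ℂ G (closedBall c ρ)) :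
    Real.posLog ‖G c‖ ≤ Real.circleAverage (fun z => Real.posLog ‖G z‖) c ρ := by
  have hρ' : |ρ| = ρ := abs_of_pos hρ
  rcases le_or_gt ‖G c‖ 1 with h | h
  · rw [(Real.posLog_eq_zero_iff _).2 (by simpa using h)]
    exact Real.circleAverage_nonneg_of_nonneg fun z _ => Real.posLog_nonneg
  · have hGc : G c ≠ 0 := norm_pos_iff.1 (one_pos.trans h)
    have hJ := AnalyticOnNhd.circleAverage_log_norm hρ.ne' (hρ'.symm ▸ hG) hGc
    have hnn : 0 ≤ ∑ᶠ u, (MeromorphicOn.divisor G (closedBall c |ρ|) u : ℝ) *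
        Real.log (ρ * ‖c - u‖⁻¹) := by
      apply finsum_nonneg
      intro u
      by_cases hu : u ∈ closedBall c |ρ|
      · apply mul_nonneg
        · exact_mod_cast MeromorphicOn.AnalyticOnNhd.divisor_nonneg (hρ'.symm ▸ hG) u
        · rcases eq_or_ne c u with rfl | hcu
          · simp
          · apply Real.log_nonneg
            rw [← div_eq_mul_inv, one_le_div (norm_pos_iff.2 (sub_ne_zero.2 hcu))]
            rw [mem_closedBall, dist_comm, dist_eq_norm, hρ'] at hu
            exact hu
      · rw [Function.locallyFinsuppWithin.apply_eq_zero_of_notMem _ hu]; simp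
    rw [Real.posLog_eq_log (by rw [abs_norm]; exact h.le)]
    calc Real.log ‖G c‖ ≤ Real.circleAverage (Real.log ‖G ·‖) c ρ := by rw [hJ]; linarith
      _ ≤ _ := by
        have hmer : MeromorphicOn G (sphere c |ρ|) :=
          (hG.mono (hρ'.symm ▸ sphere_subset_closedBall)).meromorphicOn
        apply Real.circleAverage_mono hmer.circleIntegrable_log_norm
        · apply ContinuousOn.circleIntegrable hρ.le
          exact Real.continuous_posLog.comp_continuousOn
            (hG.continuousOn.mono sphere_subset_closedBall).norm
        · exact fun z _ => le_max_right _ _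

theorem superharmonicOn_of_posLog_add_re {K Φ : ℂ → ℂ} (hK : DifferentiableOn ℂ K unitDisk)
    (hΦ : DifferentiableOn ℂ Φ unitDisk) {L : ℝ} (hL : 0 < L) :
    SuperharmonicOn (fun z => 1 - Real.posLog ‖K z‖ / L + min 1 (Φ z).re) unitDisk := by
  have hKc : ContinuousOn (fun z => Real.posLog ‖K z‖) unitDisk :=
    Real.continuous_posLog.comp_continuousOn hK.continuousOn.norm
  have hΦc : ContinuousOn (fun z => (Φ z).re) unitDisk :=
    Complex.continuous_re.comp_continuousOn hΦ.continuousOn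
  have h1c : ContinuousOn (fun z => 1 - Real.posLog ‖K z‖ / L) unitDisk :=
    continuousOn_const.sub (hKc.div_const L)
  have h2c : ContinuousOn (fun z => min 1 (Φ z).re) unitDisk := continuousOn_const.inf hΦc
  refine ⟨(h1c.add h2c).lowerSemicontinuousOn, fun c ρ hρ hsub => ?_⟩
  have hsp : sphere c ρ ⊆ unitDisk := sphere_subset_closedBall.trans hsub
  have hρ' : |ρ| = ρ := abs_of_pos hρ
  have hKi : CircleIntegrable (fun z => Real.posLog ‖K z‖) c ρ :=
    (hKc.mono hsp).circleIntegrable hρ.le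
  have h1i : CircleIntegrable (fun z => 1 - Real.posLog ‖K z‖ / L) c ρ :=
    (h1c.mono hsp).circleIntegrable hρ.le
  have h2i : CircleIntegrable (fun z => min 1 (Φ z).re) c ρ :=
    (h2c.mono hsp).circleIntegrable hρ.le
  have hΦi : CircleIntegrable (fun z => (Φ z).re) c ρ :=
    (hΦc.mono hsp).circleIntegrable hρ.le
  change Real.circleAverage (fun z => 1 - Real.posLog ‖K z‖ / L + min 1 (Φ z).re) c ρ ≤ _
  rw [Real.circleAverage_fun_add h1i h2i]
  apply add_le_add
  · have hA : AnalyticOnNhd ℂ K (closedBall c ρ) :=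
      (hK.analyticOnNhd isOpen_ball).mono hsub
    have hav := posLog_norm_le_circleAverage hρ hA
    have heq : Real.circleAverage (fun z => 1 - Real.posLog ‖K z‖ / L) c ρ
        = 1 - Real.circleAverage (fun z => Real.posLog ‖K z‖) c ρ / L := by
      rw [Real.circleAverage_fun_sub (circleIntegrable_const _ _ _)
        ((hKc.div_const L).mono hsp |>.circleIntegrable hρ.le), Real.circleAverage_const]
      have := Real.circleAverage_fun_smul (a := L⁻¹) (f := fun z => Real.posLog ‖K z‖)
        (c := c) (R := ρ)
      simp only [smul_eq_mul] at this
      simp only [div_eq_inv_mul, this]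
    rw [heq]
    gcongr
  · apply le_min
    · calc _ ≤ Real.circleAverage (fun _ => (1 : ℝ)) c ρ :=
          Real.circleAverage_mono h2i (circleIntegrable_const _ _ _) fun z _ => min_le_left _ _
        _ = 1 := Real.circleAverage_const _ _ _
    · calc _ ≤ Real.circleAverage (fun z => (Φ z).re) c ρ :=
          Real.circleAverage_mono h2i hΦi fun z _ => min_le_right _ _
        _ = (Φ c).re := by
          have hd : DiffContOnCl ℂ Φ (ball c |ρ|) := by
            rw [hρ']; exact (hΦ.mono hsub).diffContOnCl_ball subset_rfl
          have := Complex.reCLM.circleAverage_comp_comm (f := Φ) (c := c) (R := ρ)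
            ((hΦ.continuousOn.mono hsp).circleIntegrable hρ.le)
          rw [hd.circleAverage] at this
          exact this

theorem hmU_diskPreimage_le {E : Type*} [NormedAddCommGroup E] [NormedSpace ℂ E]
    [FiniteDimensional ℂ E] {f : ℂ → E} (hf : HoloDisk f) (hfb : BoundedOnDisk f)
    {V : Set E} (hV : IsOpen V) {K : ℂ → ℂ} (hK : DifferentiableOn ℂ K unitDisk)
    {L : ℝ} (hL : 0 < L) (hKL : ∀ z ∈ unitDisk, Real.posLog ‖K z‖ ≤ L)
    (hKV : ∀ z ∈ unitDisk, f z ∈ V → ‖K z‖ ≤ 1) {ζ : ℂ} (hζ : ζ ∈ unitDisk) :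
    hmU ζ (diskPreimage f V) ≤ 1 - Real.posLog ‖K ζ‖ / L := by
  obtain ⟨R, hR⟩ := hfb
  set N : Set ℝ := {θ | ¬ ∃ a : E, Tendsto (fun r : ℝ => f (r * Complex.exp (θ * Complex.I)))
      (𝓝[<] 1) (𝓝 a)} with hN
  have hN0 : volume N = 0 := ae_iff.1 (ae_exists_radial_limit_s9 hf hR)
  have hζ1 : 0 < 1 - ‖ζ‖ := by linarith [mem_ball_zero_iff.1 hζ]
  have ha0 : ∀ z ∈ unitDisk, 0 ≤ 1 - Real.posLog ‖K z‖ / L := by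
    intro z hz
    rw [sub_nonneg, div_le_one hL]
    exact hKL z hz
  have ha1 : ∀ z, 1 - Real.posLog ‖K z‖ / L ≤ 1 := fun z =>
    sub_le_self _ (div_nonneg Real.posLog_nonneg hL.le)
  have haV : ∀ z ∈ unitDisk, f z ∈ V → 1 - Real.posLog ‖K z‖ / L = 1 := by
    intro z hz hzV
    rw [(Real.posLog_eq_zero_iff _).2 (by simpa using hKV z hz hzV)]
    simp
  apply le_of_forall_pos_le_add
  intro ε hε
  obtain ⟨Φ, hΦ, hΦ0, hΦε, hΦN⟩ := exists_small_re_barrier hN0 (mul_pos hε hζ1)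
  have hv0 : ∀ z ∈ unitDisk, 0 ≤ min 1 (Φ z).re := fun z hz => le_min zero_le_one (hΦ0 z hz)
  refine le_trans (csInf_le ⟨0, ?_⟩ ⟨fun z => 1 - Real.posLog ‖K z‖ / L + min 1 (Φ z).re,
    superharmonicOn_of_posLog_add_re hK hΦ hL, fun w hw => add_nonneg (ha0 w hw) (hv0 w hw),
    ?_, ?_, rfl⟩) ?_
  · rintro _ ⟨u, -, hu, -, -, rfl⟩
    exact hu ζ hζ
  · rintro w ⟨hw | hw, hwU⟩
    · have := haV w hw.1 hw.2
      have := hv0 w hwU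
      linarith
    · exact absurd (mem_sphere_zero_iff_norm.1 hw.1) (mem_ball_zero_iff.1 hwU).ne
  · rintro w ⟨hw | hw, hwS⟩
    · exact absurd (mem_sphere_zero_iff_norm.1 hwS) (mem_ball_zero_iff.1 hw.1).ne
    have hw1 : ‖w‖ = 1 := mem_sphere_zero_iff_norm.1 hwS
    have hwe : Complex.exp ((Complex.arg w : ℂ) * Complex.I) = w := by
      simpa [hw1] using Complex.norm_mul_exp_arg_mul_I w
    have hrU : ∀ᶠ r : ℝ in 𝓝[<] 1, (r : ℂ) * w ∈ unitDisk := by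
      have h0 : ∀ᶠ r : ℝ in 𝓝[<] 1, 0 < r := nhdsWithin_le_nhds (lt_mem_nhds one_pos)
      filter_upwards [h0, self_mem_nhdsWithin] with r hr0 hr1
      rw [unitDisk, mem_ball_zero_iff, norm_mul, hw1, mul_one, Complex.norm_real,
        Real.norm_of_nonneg hr0.le]
      exact hr1
    have hev : ∀ᶠ r : ℝ in 𝓝[<] 1,
        1 ≤ 1 - Real.posLog ‖K (r * w)‖ / L + min 1 (Φ (r * w)).re := by
      by_cases hwN : Complex.arg w ∈ N
      · have := hΦN _ hwN
        rw [hwe] at this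
        filter_upwards [this, hrU] with r hr hrw
        rw [min_eq_left hr]
        linarith [ha0 _ hrw]
      · have hex : ∃ a : E, Tendsto (fun r : ℝ => f (r * w)) (𝓝[<] 1) (𝓝 a) := by
          simpa [hN, hwe] using hwN
        have hlim : Tendsto (fun r : ℝ => f (r * w)) (𝓝[<] 1) (𝓝 (radialLimit f w)) := by
          rw [radialLimit, dif_pos hex]
          exact hex.choose_spec
        filter_upwards [hlim.eventually_mem (hV.mem_nhds hw.2), hrU] with r hr hrw
        linarith [haV _ hrw hr, hv0 _ hrw]
    apply le_liminf_of_le _ hev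
    apply IsBoundedUnder.isCoboundedUnder_ge
    exact isBoundedUnder_of ⟨2, fun r => by linarith [ha1 (r * w), min_le_left 1 (Φ (r * w)).re]⟩
  · refine add_le_add le_rfl ?_
    refine (min_le_right _ _).trans ((hΦε ζ hζ).trans_eq ?_)
    field_simp

section TwoConstants

variable {E : Type*} [NormedAddCommGroup E]

theorem hmU_nonneg {ζ : ℂ} (hζ : ζ ∈ unitDisk) (A : Set ℂ) : 0 ≤ hmU ζ A := by
  apply Real.sInf_nonneg
  rintro t ⟨u, -, hu, -, -, rfl⟩
  exact hu ζ hζ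

theorem omDisk_nonneg (f : ℂ → E) (V : Set E) (z : E) : 0 ≤ omDisk f V z := by
  apply Real.sSup_nonneg
  rintro t ⟨ζ, hζ, -, rfl⟩
  exact hmU_nonneg hζ _

theorem omCluster_nonneg (f : ℕ → ℂ → E) (V : Set E) (z : E) : 0 ≤ omCluster f V z := by
  rw [omCluster, limsup_eq]
  apply Real.sInf_nonneg
  intro a ha
  obtain ⟨p, hp⟩ := (show ∀ᶠ p : E × ℕ in 𝓝 z ×ˢ atTop, omDisk (f p.2) V p.1 ≤ a from ha).exists
  exact (omDisk_nonneg _ _ _).trans hp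

theorem omClusterSet_nonneg (f : ℕ → ℂ → E) (A : Set E) (z : E) : 0 ≤ omClusterSet f A z := by
  apply Real.sInf_nonneg
  rintro t ⟨V, -, -, rfl⟩
  exact omCluster_nonneg f V z

theorem omClusterSet_le_omCluster (f : ℕ → ℂ → E) {A V : Set E} (hV : IsOpen V) (hAV : A ⊆ V)
    (z : E) : omClusterSet f A z ≤ omCluster f V z := by
  refine csInf_le ⟨0, ?_⟩ ⟨V, hV, hAV, rfl⟩
  rintro t ⟨W, -, -, rfl⟩
  exact omCluster_nonneg f W z

/-- A bound for `omDisk` near `z` by a function continuous at `z` bounds `omCluster` at `z`. -/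
theorem omCluster_le_of_continuousAt {f : ℕ → ℂ → E} {V : Set E} {z : E} {φ : E → ℝ}
    (hφ : ContinuousAt φ z)
    (h : ∀ᶠ p : E × ℕ in 𝓝 z ×ˢ atTop, omDisk (f p.2) V p.1 ≤ φ p.1) :
    omCluster f V z ≤ φ z := by
  refine le_of_forall_pos_le_add fun δ hδ => ?_
  refine limsup_le_of_le ?_ ?_
  · apply IsBoundedUnder.isCoboundedUnder_le
    exact isBoundedUnder_of ⟨0, fun p => omDisk_nonneg _ _ _⟩
  · have h1 : ∀ᶠ w in 𝓝 z, φ w < φ z + δ := hφ.eventually_lt_const (by linarith)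
    filter_upwards [h, tendsto_fst.eventually h1] with p hp hp1
    exact hp.trans hp1.le

theorem hmU_empty_nonpos (ζ : ℂ) : hmU ζ ∅ ≤ 0 := by
  by_cases hb : BddBelow {t : ℝ | ∃ u : ℂ → ℝ, SuperharmonicOn u unitDisk ∧
    (∀ w ∈ unitDisk, 0 ≤ u w) ∧ (∀ w ∈ (∅ : Set ℂ) ∩ unitDisk, 1 ≤ u w) ∧
    (∀ w ∈ (∅ : Set ℂ) ∩ unitCircleS,
      1 ≤ Filter.liminf (fun r : ℝ => u ((r : ℂ) * w)) (𝓝[<] (1:ℝ))) ∧ t = u ζ}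
  · refine csInf_le hb ⟨fun _ => 0, ⟨?_, ?_⟩, ?_, ?_, ?_, rfl⟩
    · exact lowerSemicontinuous_const.lowerSemicontinuousOn _
    · intro c ρ _ _
      simp
    all_goals simp
  · exact (Real.sInf_of_not_bddBelow hb).le

theorem omClusterSet_empty (f : ℕ → ℂ → E) (z : E) : omClusterSet f ∅ z = 0 := by
  refine le_antisymm ?_ (omClusterSet_nonneg f ∅ z)
  refine (omClusterSet_le_omCluster f isOpen_empty subset_rfl z).trans ?_
  refine omCluster_le_of_continuousAt (φ := fun _ => 0) continuousAt_const (.of_forall fun p => ?_)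
  refine Real.sSup_le ?_ le_rfl
  rintro t ⟨ζ, -, -, rfl⟩
  simpa [diskPreimage] using hmU_empty_nonpos ζ

theorem isClosed_cluster (f : ℕ → ℂ → E) : IsClosed (cluster f) := by
  rw [← closure_subset_iff_isClosed]
  intro z hz V hV
  obtain ⟨W, hWV, hW, hzW⟩ := _root_.mem_nhds_iff.1 hV
  obtain ⟨y, hyW, hy⟩ := mem_closure_iff.1 hz W hW hzW
  refine (hy W (hW.mem_nhds hyW)).mono ?_
  rintro j ⟨ζ, hζ, h⟩
  exact ⟨ζ, hζ, hWV h⟩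

theorem cluster_subset_closedBall {f : ℕ → ℂ → E} {R : ℝ}
    (hR : ∀ j, ∀ ζ ∈ unitDisk, ‖f j ζ‖ ≤ R) : cluster f ⊆ closedBall 0 R := by
  intro z hz
  by_contra hzR
  obtain ⟨j, ζ, hζ, hj⟩ := (hz _ (isClosed_closedBall.isOpen_compl.mem_nhds hzR)).nonempty
  exact hj (mem_closedBall_zero_iff.2 (hR j ζ hζ))

variable [NormedSpace ℂ E] [FiniteDimensional ℂ E]

theorem isCompact_cluster {f : ℕ → ℂ → E} (hb : UnifBounded f) : IsCompact (cluster f) := by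
  have := FiniteDimensional.proper ℂ E
  obtain ⟨R, hR⟩ := hb
  exact (isCompact_closedBall 0 R).of_isClosed_subset (isClosed_cluster f)
    (cluster_subset_closedBall hR)

/-- The images of a uniformly bounded sequence are eventually contained in any given
neighborhood of its cluster. -/
theorem eventually_mapsTo_of_cluster_subset {f : ℕ → ℂ → E} (hb : UnifBounded f) {V : Set E}
    (hV : IsOpen V) (hfV : cluster f ⊆ V) : ∀ᶠ j in atTop, MapsTo (f j) unitDisk V := by
  have := FiniteDimensional.proper ℂ E
  obtain ⟨R, hR⟩ := hb
  have hK : IsCompact (closedBall (0 : E) R \ V) := (isCompact_closedBall 0 R).diff hV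
  have hloc : ∀ x ∈ closedBall (0 : E) R \ V,
      ∃ t ∈ 𝓝[closedBall (0 : E) R \ V] x, ∀ᶠ j in atTop, ∀ ζ ∈ unitDisk, f j ζ ∉ t := by
    intro x hx
    have hxc : x ∉ cluster f := fun h => hx.2 (hfV h)
    simp only [cluster, mem_ofPred_eq, not_forall, Set.not_infinite] at hxc
    obtain ⟨t, ht, hfin⟩ := hxc
    refine ⟨t, mem_nhdsWithin_of_mem_nhds ht, ?_⟩
    have := hfin.eventually_cofinite_notMem
    rw [Nat.cofinite_eq_atTop] at this
    filter_upwards [this] with j hj ζ hζ hjt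
    exact hj ⟨ζ, hζ, hjt⟩
  have hmain : ∀ᶠ j in atTop, ∀ ζ ∈ unitDisk, f j ζ ∉ closedBall (0 : E) R \ V := by
    refine hK.induction_on (p := fun t => ∀ᶠ j in atTop, ∀ ζ ∈ unitDisk, f j ζ ∉ t) ?_ ?_ ?_ hloc
    · simp
    · intro s t hst ht
      filter_upwards [ht] with j hj ζ hζ hs
      exact hj ζ hζ (hst hs)
    · intro s t hs ht
      filter_upwards [hs, ht] with j hj1 hj2 ζ hζ hst
      exact hst.elim (hj1 ζ hζ) (hj2 ζ hζ)
  filter_upwards [hmain] with j hj ζ hζ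
  by_contra hζV
  exact hj ζ hζ ⟨mem_closedBall_zero_iff.2 (hR j ζ hζ), hζV⟩

/-- Two-constants theorem for a function holomorphic near the cluster. -/
theorem norm_le_rpow_mul_rpow_omClusterSet {f : ℕ → ℂ → E} (hb : UnifBounded f)
    (hh : ∀ j, HoloDisk (f j)) {V : Set E} (hV : IsOpen V) (hfV : cluster f ⊆ V) {g : E → ℂ}
    (hg : DifferentiableOn ℂ g V) {M m : ℝ} (hm : 0 < m) (hmM : m < M)
    (hgM : ∀ z ∈ cluster f, ‖g z‖ < M) {A : Set E} (hA : A ⊆ cluster f)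
    (hgm : ∀ z ∈ A, ‖g z‖ < m) {z : E} (hz : z ∈ cluster f) :
    ‖g z‖ ≤ m ^ omClusterSet f A z * M ^ (1 - omClusterSet f A z) := by
  have hM : 0 < M := hm.trans hmM
  have hgc : ContinuousOn g V := hg.continuousOn
  have hsub : ∀ c : ℝ, IsOpen (V ∩ {w | ‖g w‖ < c}) := fun c =>
    hgc.norm.isOpen_inter_preimage hV isOpen_Iio
  set V₁ := V ∩ {w | ‖g w‖ < M} with hV₁
  set V₂ := V ∩ {w | ‖g w‖ < m} with hV₂
  have hL : 0 < Real.log (M / m) := Real.log_pos ((one_lt_div hm).2 hmM)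
  set φ : E → ℝ := fun w => 1 - Real.posLog (‖g w‖ / m) / Real.log (M / m) with hφ
  have hlog : ∀ w ∈ V₁, Real.posLog (‖g w‖ / m) ≤ Real.log (M / m) := by
    intro w hw
    have h1 : |M / m| ≥ 1 := by
      rw [abs_of_pos (by positivity)]
      exact ((one_lt_div hm).2 hmM).le
    rw [← Real.posLog_eq_log h1]
    refine Real.posLog_le_posLog (by positivity) ?_
    gcongr
    exact hw.2.le
  have hφ0 : ∀ w ∈ V₁, 0 ≤ φ w := fun w hw => sub_nonneg.2 ((div_le_one hL).2 (hlog w hw))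
  have hom : omCluster f V₂ z ≤ φ z := by
    refine omCluster_le_of_continuousAt ?_ ?_
    · have : ContinuousAt g z := hgc.continuousAt (hV.mem_nhds (hfV hz))
      exact continuousAt_const.sub ((Real.continuous_posLog.continuousAt.comp
        (this.norm.div_const m)).div_const _)
    · have h1 : ∀ᶠ w in 𝓝 z, w ∈ V₁ := (hsub M).mem_nhds ⟨hfV hz, hgM z hz⟩
      have h2 := eventually_mapsTo_of_cluster_subset hb (hsub M) fun w hw => ⟨hfV hw, hgM w hw⟩
      filter_upwards [h1.prod_mk h2] with p ⟨hp1, hp2⟩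
      refine Real.sSup_le ?_ (hφ0 _ hp1)
      rintro t ⟨ζ, hζ, hζp, rfl⟩
      have hnorm : ∀ w, ‖g (f p.2 w) / m‖ = ‖g (f p.2 w)‖ / m := fun w => by
        rw [norm_div, Complex.norm_real, Real.norm_of_nonneg hm.le]
      have := hmU_diskPreimage_le (K := fun w => g (f p.2 w) / m) (hh p.2)
        (hb.imp fun R hR => hR p.2) (hsub m)
        ((hg.comp (hh p.2) fun w hw => (hp2 hw).1).div_const _) hL
        (fun w hw => by
          rw [hnorm]
          exact hlog _ (hp2 hw))
        (fun w _ hw => by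
          rw [hnorm]
          exact (div_le_one hm).2 hw.2.le) hζ
      rwa [hnorm, hζp] at this
  have hd : omClusterSet f A z ≤ φ z :=
    (omClusterSet_le_omCluster f (hsub m) (fun w hw => ⟨hfV (hA hw), hgm w hw⟩) z).trans hom
  set d := omClusterSet f A z
  have hlogd : Real.posLog (‖g z‖ / m) ≤ (1 - d) * Real.log (M / m) := by
    rw [← div_le_iff₀ hL]
    simp only [hφ] at hd
    linarith
  have hexp : ‖g z‖ / m ≤ (M / m) ^ (1 - d) := by
    rcases (norm_nonneg (g z)).eq_or_lt with h0 | h0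
    · rw [← h0, zero_div]
      positivity
    · rw [Real.rpow_def_of_pos (by positivity), mul_comm, ← Real.log_le_iff_le_exp (by positivity)]
      exact (le_max_right _ _).trans hlogd
  calc ‖g z‖ ≤ m * (M / m) ^ (1 - d) := by rwa [div_le_iff₀' hm] at hexp
    _ = m ^ d * M ^ (1 - d) := by
      rw [Real.div_rpow hM.le hm.le, Real.rpow_sub hm, Real.rpow_one]
      have := Real.rpow_pos_of_pos hm d
      field_simp

end TwoConstants

/-- Theorem 4.3, two-constants theorem: if `h ∈ 𝓗(L)` satisfies
`|h| < M₀` on the cluster and `|h| < m₀ < M₀` on a set `A`, then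
`|h z| ≤ m₀^d · M₀^(1-d)` with `d = ω(z, A, L)`. -/
theorem statement9 {n : ℕ} (f : ℕ → ℂ → En n) (hb : UnifBounded f)
    (hh : ∀ j, HoloDisk (f j)) (h : En n → ℂ) (hHL : InHL f h)
    (M₀ m₀ : ℝ) (hmM : m₀ < M₀) (hM : ∀ z ∈ cluster f, ‖h z‖ < M₀)
    (A : Set (En n)) (hA : A ⊆ cluster f) (hmA : ∀ z ∈ A, ‖h z‖ < m₀) :
    ∀ z ∈ cluster f,
      ‖h z‖ ≤ m₀ ^ (omClusterSet f A z) * M₀ ^ (1 - omClusterSet f A z) := by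

  intro z hz
  rcases le_or_gt m₀ 0 with hm₀ | hm₀
  · have hAe : A = ∅ := eq_empty_of_forall_notMem fun w hw =>
      (norm_nonneg (h w)).not_gt ((hmA w hw).trans_le hm₀)
    rw [hAe, omClusterSet_empty, Real.rpow_zero, sub_zero, Real.rpow_one, one_mul]
    exact (hM z hz).le
  obtain ⟨w, hw, hmax⟩ := (isCompact_cluster hb).exists_isMaxOn ⟨z, hz⟩ hHL.1.norm
  have hδ : ∀ᶠ ε : ℝ in 𝓝[>] 0, ε < M₀ - m₀ ∧ ε < M₀ - ‖h w‖ :=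
    nhdsWithin_le_nhds ((gt_mem_nhds (sub_pos.2 hmM)).and (gt_mem_nhds (sub_pos.2 (hM w hw))))
  have hbound : ∀ᶠ ε : ℝ in 𝓝[>] 0, ‖h z‖ ≤
      (m₀ + ε) ^ omClusterSet f A z * M₀ ^ (1 - omClusterSet f A z) + ε := by
    filter_upwards [hδ, self_mem_nhdsWithin] with ε ⟨hε1, hε2⟩ hε0
    obtain ⟨V, g, hV, hfV, hg, hhg⟩ := hHL.2 ε hε0
    have hgh : ∀ y ∈ cluster f, ‖g y‖ ≤ ‖h y‖ + ε := fun y hy => by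
      have := norm_sub_norm_le (g y) (h y)
      rw [norm_sub_rev] at this
      linarith [hhg y hy]
    have hgz := norm_le_rpow_mul_rpow_omClusterSet hb hh hV hfV hg
      (m := m₀ + ε) (M := M₀) (add_pos hm₀ hε0) (by linarith)
      (fun y hy => by linarith [hgh y hy, isMaxOn_iff.1 hmax y hy]) hA
      (fun y hy => by linarith [hgh y (hA hy), hmA y hy]) hz
    have := norm_sub_norm_le (h z) (g z)
    linarith [hhg z hz]
  have hlim : Tendsto (fun ε : ℝ =>
      (m₀ + ε) ^ omClusterSet f A z * M₀ ^ (1 - omClusterSet f A z) + ε) (𝓝[>] 0)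
      (𝓝 ((m₀ + 0) ^ omClusterSet f A z * M₀ ^ (1 - omClusterSet f A z) + 0)) := by
    refine Tendsto.mono_left ?_ nhdsWithin_le_nhds
    have h1 : Tendsto (fun ε : ℝ => m₀ + ε) (𝓝 0) (𝓝 (m₀ + 0)) := tendsto_id.const_add m₀
    exact ((h1.rpow_const (Or.inl (by linarith))).mul_const _).add tendsto_id
  rw [add_zero, add_zero] at hlim
  exact ge_of_tendsto hlim hbound

end
end
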